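/- arXiv:1404.0608 — 2 statements merged into one kernel-verified Lean document; each statement's English description precedes it below -/
import Mathlib

section
/- Let a, ℓ, d be real numbers with aℓ < 0, ℓ ≠ 0, d > 0, let n₁ be an integer greater than 1, let r ≥ 0, and set D = 53747712 a⁵ d² / (78125 ℓ⁷) + 20480 d⁴ / ℓ⁴. If D = 0 then there exists ε₀ > 0 such that for every ε ∈ (0, ε₀) the system ẋ = y, ẏ = −x + ε^{n₁} r y − ε^{n₁} r x² y − ε a x³ − ε ℓ x⁵ + ε d cos t has at least one 2π-periodic solution; if D < 0 then for every ε ∈ (0, ε₀) this system has at least three distinct 2π-periodic solutions, whose initial conditions converge, as ε → 0⁺, to the three distinct real zeros of the map (x₀, y₀) ↦ ( y₀(x₀²+y₀²)(6a+5ℓ(x₀²+y₀²)), 8d − x₀(x₀²+y₀²)(6a+5ℓ(x₀²+y₀²)) ). Moreover there exist values of a, ℓ, d (hence of α, λ, δ) realizing each of these two alternatives. -/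
/-- The discriminant quantity `D` of Theorem 5 of the paper. -/
noncomputable def D5 (a l d : ℝ) : ℝ :=
  53747712 * a ^ 5 * d ^ 2 / (78125 * l ^ 7) + 20480 * d ^ 4 / l ^ 4

/-- The first-order averaged map of Theorem 5 of the paper (up to the factor `π/8`). -/
noncomputable def F5 (a l d : ℝ) (z : ℝ × ℝ) : ℝ × ℝ :=
  (z.2 * (z.1 ^ 2 + z.2 ^ 2) * (6 * a + 5 * l * (z.1 ^ 2 + z.2 ^ 2)),
   8 * d - z.1 * (z.1 ^ 2 + z.2 ^ 2) * (6 * a + 5 * l * (z.1 ^ 2 + z.2 ^ 2)))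

open Filter Topology intervalIntegral

/-- A form of Lyapunov–Schmidt reduction for `z = c (ev z) + ε • K (G (ε, z))`, `M (G (ε, z)) = 0`:
a nondegenerate zero `v₀` of the reduced map `v ↦ M (G (0, c v))` continues to a branch of
solutions for small `ε`. -/
theorem exists_branch_of_nondegenerate_zero {V E : Type*}
    [NormedAddCommGroup V] [NormedSpace ℝ V] [FiniteDimensional ℝ V]
    [NormedAddCommGroup E] [NormedSpace ℝ E] [CompleteSpace E]
    (c : V →L[ℝ] E) (ev M : E →L[ℝ] V) (K : E →L[ℝ] E)
    (hevc : ∀ v, ev (c v) = v) (hevK : ∀ f, ev (K f) = 0)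
    {G : ℝ × E → E} {G' : ℝ × E →L[ℝ] E} {v₀ : V}
    (hG : HasStrictFDerivAt G G' (0, c v₀)) (h0 : M (G (0, c v₀)) = 0)
    (hinj : ∀ v, M (G' (0, c v)) = 0 → v = 0) :
    ∃ φ : ℝ → E, Tendsto φ (𝓝 0) (𝓝 (c v₀)) ∧
      ∀ᶠ ε in 𝓝 0, M (G (ε, φ ε)) = 0 ∧ φ ε = c (ev (φ ε)) + ε • K (G (ε, φ ε)) := by
  set F : ℝ × E → E := fun p =>
    p.2 - c (ev p.2) - p.1 • K (G p) + c (M (G p)) with hF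
  have hFd := ((hasStrictFDerivAt_snd (𝕜 := ℝ) (p := ((0 : ℝ), c v₀))).sub
    ((c ∘L ev).hasStrictFDerivAt.comp _ hasStrictFDerivAt_snd)).sub
    (hasStrictFDerivAt_fst.smul (K.hasStrictFDerivAt.comp _ hG)) |>.add
    ((c ∘L M).hasStrictFDerivAt.comp _ hG)
  set F' := _
  change HasStrictFDerivAt F F' _ at hFd
  have hF0 : F (0, c v₀) = 0 := by simp [hF, h0, hevc]
  have hF' : ∀ ζ, (F' ∘L .inr ℝ ℝ E) ζ = ζ - c (ev ζ) + c (M (G' (0, ζ))) := by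
    intro ζ
    simp [F']
  have hinv : (F' ∘L .inr ℝ ℝ E).IsInvertible := by
    set A : V →ₗ[ℝ] V := (M ∘L G' ∘L .inr ℝ ℝ E ∘L c).toLinearMap with hA
    have hAinj : Function.Injective A :=
      (injective_iff_map_eq_zero _).2 fun v hv => hinj v (by simpa [hA] using hv)
    have hAsurj : Function.Surjective A := LinearMap.injective_iff_surjective.1 hAinj
    have hadd : ∀ x y, G' (0, x + y) = G' (0, x) + G' (0, y) := fun x y => by
      rw [← map_add]; simp
    refine ⟨ContinuousLinearEquiv.ofBijective (F' ∘L .inr ℝ ℝ E) ?_ ?_,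
      ContinuousLinearEquiv.coe_ofBijective _ _ _⟩
    · refine LinearMap.ker_eq_bot'.2 fun ζ hζ => ?_
      have hζ : ζ - c (ev ζ) + c (M (G' (0, ζ))) = 0 := by rw [← hF']; exact hζ
      have h1 : M (G' (0, ζ)) = 0 := by simpa [hevc] using congrArg ev hζ
      have h2 : ζ = c (ev ζ) := by simpa [h1, sub_eq_zero] using hζ
      rw [h2] at h1
      rw [h2, hinj _ h1, map_zero]
    · refine LinearMap.range_eq_top.2 fun η => ?_
      obtain ⟨w, hw⟩ := hAsurj (ev η - M (G' (0, η - c (ev η))))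
      refine ⟨c w + (η - c (ev η)), ?_⟩
      change (F' ∘L .inr ℝ ℝ E) _ = _
      have hw : M (G' (0, c w)) = ev η - M (G' (0, η - c (ev η))) := by simpa [hA] using hw
      rw [hF', hadd]
      simp [hw, hevc]
  refine ⟨hFd.implicitFunctionOfProdDomain hinv, hFd.tendsto_implicitFunctionOfProdDomain hinv, ?_⟩
  filter_upwards [hFd.eventually_apply_implicitFunctionOfProdDomain hinv] with ε hε
  rw [hF0] at hε
  set z := hFd.implicitFunctionOfProdDomain hinv ε
  have hε : z - c (ev z) - ε • K (G (ε, z)) + c (M (G (ε, z))) = 0 := hε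
  have h1 : M (G (ε, z)) = 0 := by simpa [hevc, hevK] using congrArg ev hε
  refine ⟨h1, ?_⟩
  rw [h1, map_zero, add_zero, sub_sub, sub_eq_zero] at hε
  exact hε

section Circle

variable (T : ℝ) [hT : Fact (0 < T)]

/-- The continuous function on the circle induced by a continuous periodic function. -/
def Function.Periodic.liftContinuousMap {T : ℝ} {f : ℝ → ℝ} (hp : Function.Periodic f T)
    (hf : Continuous f) : C(AddCircle T, ℝ) :=
  ⟨hp.lift, continuous_coinduced_dom.2 hf⟩

@[simp]
theorem Function.Periodic.liftContinuousMap_coe {T : ℝ} {f : ℝ → ℝ} (hp : Function.Periodic f T)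
    (hf : Continuous f) (t : ℝ) : hp.liftContinuousMap hf (t : AddCircle T) = f t := rfl

theorem AddCircle.intervalIntegrable_coe {T : ℝ} (f : C(AddCircle T, ℝ)) (s t : ℝ) :
    IntervalIntegrable (fun τ : ℝ => f (τ : AddCircle T)) MeasureTheory.volume s t :=
  (f.continuous.comp (AddCircle.continuous_mk' T)).intervalIntegrable _ _

theorem AddCircle.abs_intervalIntegral_le {T : ℝ} [Fact (0 < T)] (f : C(AddCircle T, ℝ)) {t : ℝ}
    (ht : t ∈ Set.Icc 0 T) : |∫ τ in (0 : ℝ)..t, f (τ : AddCircle T)| ≤ T * ‖f‖ := by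
  have h := intervalIntegral.norm_integral_le_of_norm_le_const (a := 0) (b := t)
    (f := fun τ : ℝ => f (τ : AddCircle T)) fun τ _ => f.norm_coe_le_norm τ
  rw [sub_zero, abs_of_nonneg ht.1] at h
  exact h.trans (by nlinarith [ht.2, norm_nonneg f])

/-- Integration over one period. -/
noncomputable def AddCircle.periodIntegral : C(AddCircle T, ℝ) →L[ℝ] ℝ :=
  LinearMap.mkContinuous
    { toFun := fun f => ∫ τ in (0 : ℝ)..T, f (τ : AddCircle T)
      map_add' := fun f g =>
        integral_add (AddCircle.intervalIntegrable_coe f _ _)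
          (AddCircle.intervalIntegrable_coe g _ _)
      map_smul' := fun r _ => integral_const_mul r _ }
    T fun f => AddCircle.abs_intervalIntegral_le f ⟨hT.out.le, le_rfl⟩

theorem AddCircle.periodIntegral_apply (f : C(AddCircle T, ℝ)) :
    AddCircle.periodIntegral T f = ∫ τ in (0 : ℝ)..T, f (τ : AddCircle T) := rfl

theorem AddCircle.periodic_primitive_sub (f : C(AddCircle T, ℝ)) :
    Function.Periodic (fun t : ℝ => (∫ τ in (0 : ℝ)..t, f (τ : AddCircle T))
      - t / T * AddCircle.periodIntegral T f) T := by
  intro t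
  have hT0 := hT.out.ne'
  have h1 := integral_add_adjacent_intervals (AddCircle.intervalIntegrable_coe f 0 t)
    (AddCircle.intervalIntegrable_coe f t (t + T))
  have hp : Function.Periodic (fun τ : ℝ => f (τ : AddCircle T)) T := fun τ => by simp
  have h2 := hp.intervalIntegral_add_eq t 0
  rw [zero_add] at h2
  simp only [AddCircle.periodIntegral_apply]
  rw [← h1, h2]
  field_simp
  ring

/-- The primitive vanishing at `0` of a continuous function on the circle, corrected by a linear
term so that it is again periodic. -/
noncomputable def AddCircle.primitive : C(AddCircle T, ℝ) →L[ℝ] C(AddCircle T, ℝ) :=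
  LinearMap.mkContinuous
    { toFun := fun f => (AddCircle.periodic_primitive_sub T f).liftContinuousMap
        ((continuous_primitive (AddCircle.intervalIntegrable_coe f) 0).sub (by fun_prop))
      map_add' := fun f g => by
        ext x
        induction x using QuotientAddGroup.induction_on with | H t => ?_
        simp only [Function.Periodic.liftContinuousMap_coe, ContinuousMap.add_apply, map_add]
        rw [integral_add (AddCircle.intervalIntegrable_coe f _ _)
          (AddCircle.intervalIntegrable_coe g _ _)]
        ring
      map_smul' := fun r f => by
        ext x
        induction x using QuotientAddGroup.induction_on with | H t => ?_
        simp only [Function.Periodic.liftContinuousMap_coe, ContinuousMap.smul_apply, map_smul,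
          smul_eq_mul, integral_const_mul, RingHom.id_apply]
        ring }
    (2 * T) fun f => by
      refine (ContinuousMap.norm_le _ (by have := hT.out; positivity)).2 fun x => ?_
      obtain ⟨t, ht, rfl⟩ : x ∈ ((↑) : ℝ → AddCircle T) '' Set.Icc 0 (0 + T) := by
        rw [AddCircle.coe_image_Icc_eq]; trivial
      rw [zero_add] at ht
      change |(∫ τ in (0 : ℝ)..t, f (τ : AddCircle T)) - t / T * AddCircle.periodIntegral T f| ≤ _
      refine (abs_sub _ _).trans ?_
      have h1 := AddCircle.abs_intervalIntegral_le f ht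
      have h2 := AddCircle.abs_intervalIntegral_le f ⟨hT.out.le, le_rfl⟩
      have h3 : |t / T| ≤ 1 := by
        rw [abs_of_nonneg (div_nonneg ht.1 hT.out.le)]
        exact (div_le_one hT.out).2 ht.2
      rw [abs_mul, AddCircle.periodIntegral_apply]
      nlinarith [abs_nonneg (∫ τ in (0 : ℝ)..T, f (τ : AddCircle T)), abs_nonneg (t / T)]

theorem AddCircle.primitive_coe (f : C(AddCircle T, ℝ)) (t : ℝ) :
    AddCircle.primitive T f (t : AddCircle T) =
      (∫ τ in (0 : ℝ)..t, f (τ : AddCircle T)) - t / T * AddCircle.periodIntegral T f := rfl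

theorem AddCircle.hasDerivAt_primitive {f : C(AddCircle T, ℝ)}
    (hf : AddCircle.periodIntegral T f = 0) (t : ℝ) :
    HasDerivAt (fun t : ℝ => AddCircle.primitive T f (t : AddCircle T))
      (f (t : AddCircle T)) t := by
  simp only [AddCircle.primitive_coe, hf, mul_zero, sub_zero]
  have hc := f.continuous.comp (AddCircle.continuous_mk' T)
  exact hc.integral_hasStrictDerivAt 0 t |>.hasDerivAt

end Circle

section TrigIntegral

open Real

theorem integral_even_cos_add_sin_mul_odd_cos (p₂ p₄ p₆ q₁ q₃ q₅ : ℝ) :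
    ∫ t in (0 : ℝ)..(2 * π), (p₂ * cos t ^ 2 + p₄ * cos t ^ 4 + p₆ * cos t ^ 6
      + sin t * (q₁ * cos t + q₃ * cos t ^ 3 + q₅ * cos t ^ 5)) =
      π * (p₂ + 3 / 4 * p₄ + 5 / 8 * p₆) := by
  have key : ∀ t : ℝ, HasDerivAt (fun t => p₂ * ((t + cos t * sin t) / 2)
      + p₄ * (3 / 8 * t + 3 / 8 * (cos t * sin t) + cos t ^ 3 * sin t / 4)
      + p₆ * (5 / 16 * t + 5 / 16 * (cos t * sin t) + 5 / 24 * (cos t ^ 3 * sin t)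
        + cos t ^ 5 * sin t / 6)
      - (q₁ * (cos t ^ 2 / 2) + q₃ * (cos t ^ 4 / 4) + q₅ * (cos t ^ 6 / 6)))
      (p₂ * cos t ^ 2 + p₄ * cos t ^ 4 + p₆ * cos t ^ 6
      + sin t * (q₁ * cos t + q₃ * cos t ^ 3 + q₅ * cos t ^ 5)) t := by
    intro t
    have hc := hasDerivAt_cos t
    have hs := hasDerivAt_sin t
    have hi := hasDerivAt_id' t
    have h1 := hc.mul hs
    have h3 := (hc.pow 3).mul hs
    have h5 := (hc.pow 5).mul hs
    refine ((((((hi.add h1).div_const 2).const_mul p₂).add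
      ((((hi.const_mul (3 / 8)).add (h1.const_mul (3 / 8))).add (h3.div_const 4)).const_mul p₄)).add
      (((((hi.const_mul (5 / 16)).add (h1.const_mul (5 / 16))).add (h3.const_mul (5 / 24))).add
        (h5.div_const 6)).const_mul p₆)).sub
      (((((hc.pow 2).div_const 2).const_mul q₁).add (((hc.pow 4).div_const 4).const_mul q₃)).add
        (((hc.pow 6).div_const 6).const_mul q₅))).congr_deriv ?_
    norm_num
    ring_nf
    simp only [sin_sq]
    ring
  rw [integral_eq_sub_of_hasDerivAt (fun t _ => key t)
    (Continuous.intervalIntegrable (by fun_prop) _ _)]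
  simp
  ring

end TrigIntegral

section Averaging

open Real

local instance : Fact (0 < 2 * π) := ⟨two_pi_pos⟩

/-- The cosine as a function on the circle of length `2π`. -/
noncomputable def circleCos : C(AddCircle (2 * π), ℝ) :=
  cos_periodic.liftContinuousMap continuous_cos

/-- The sine as a function on the circle of length `2π`. -/
noncomputable def circleSin : C(AddCircle (2 * π), ℝ) :=
  sin_periodic.liftContinuousMap continuous_sin

theorem circleCos_coe (t : ℝ) : circleCos (t : AddCircle (2 * π)) = cos t := rfl

theorem circleSin_coe (t : ℝ) : circleSin (t : AddCircle (2 * π)) = sin t := rfl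

/-- The perturbation in the extended Duffing–Van der Pol equation, divided by `ε`, as a function of
`ε` and of `w = (u, v)`, where `(x, y) = (u cos t + v sin t, v cos t - u sin t)`. -/
noncomputable def duffingForce (a l d r : ℝ) (k : ℕ)
    (p : ℝ × C(AddCircle (2 * π), ℝ) × C(AddCircle (2 * π), ℝ)) : C(AddCircle (2 * π), ℝ) :=
  (p.1 ^ (k + 1) * r) • ((p.2.2 * circleCos - p.2.1 * circleSin) *
      (1 - (p.2.1 * circleCos + p.2.2 * circleSin) ^ 2))
    - a • (p.2.1 * circleCos + p.2.2 * circleSin) ^ 3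
    - l • (p.2.1 * circleCos + p.2.2 * circleSin) ^ 5 + d • circleCos

/-- The vector field of the extended Duffing–Van der Pol system in rotating coordinates, divided by
`ε`. -/
noncomputable def duffingField (a l d r : ℝ) (k : ℕ)
    (p : ℝ × C(AddCircle (2 * π), ℝ) × C(AddCircle (2 * π), ℝ)) :
    C(AddCircle (2 * π), ℝ) × C(AddCircle (2 * π), ℝ) :=
  (-circleSin * duffingForce a l d r k p, circleCos * duffingForce a l d r k p)

theorem contDiff_duffingField (a l d r : ℝ) (k : ℕ) : ContDiff ℝ 1 (duffingField a l d r k) := by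
  unfold duffingField duffingForce
  fun_prop

theorem duffingForce_coe (a l d r : ℝ) (k : ℕ) (ε : ℝ) (u v : C(AddCircle (2 * π), ℝ)) (t : ℝ) :
    duffingForce a l d r k (ε, u, v) t =
      ε ^ (k + 1) * r * ((v t * cos t - u t * sin t) * (1 - (u t * cos t + v t * sin t) ^ 2))
      - a * (u t * cos t + v t * sin t) ^ 3 - l * (u t * cos t + v t * sin t) ^ 5 + d * cos t := by
  simp [duffingForce, circleCos_coe, circleSin_coe]

/-- The embedding of the constants into the pairs of continuous functions on the circle. -/
noncomputable def circleConst :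
    ℝ × ℝ →L[ℝ] C(AddCircle (2 * π), ℝ) × C(AddCircle (2 * π), ℝ) :=
  (algebraMapCLM ℝ C(AddCircle (2 * π), ℝ)).prodMap (algebraMapCLM ℝ C(AddCircle (2 * π), ℝ))

theorem circleConst_apply (z : ℝ × ℝ) :
    circleConst z = (algebraMap ℝ _ z.1, algebraMap ℝ _ z.2) := rfl

theorem periodIntegral_duffingField {a l d r : ℝ} (k : ℕ) {x : ℝ}
    (hx : 6 * a * x ^ 3 + 5 * l * x ^ 5 = 8 * d) :
    (AddCircle.periodIntegral (2 * π)).prodMap (AddCircle.periodIntegral (2 * π))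
      (duffingField a l d r k (0, circleConst (x, 0))) = 0 := by
  refine Prod.ext ?_ ?_
  · change AddCircle.periodIntegral (2 * π) (-circleSin * _) = 0
    rw [AddCircle.periodIntegral_apply]
    convert integral_even_cos_add_sin_mul_odd_cos 0 0 0 (-d) (a * x ^ 3) (l * x ^ 5) using 1
    · congr 1
      ext t
      simp [circleConst_apply, duffingForce_coe, circleSin_coe]
      ring
    · simp
  · change AddCircle.periodIntegral (2 * π) (circleCos * _) = 0
    rw [AddCircle.periodIntegral_apply]
    convert integral_even_cos_add_sin_mul_odd_cos d (-a * x ^ 3) (-l * x ^ 5) 0 0 0 using 1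
    · congr 1
      ext t
      simp [circleConst_apply, duffingForce_coe, circleCos_coe]
      ring
    · linear_combination π / 8 * hx

theorem fderiv_duffingField (a l d r : ℝ) (k : ℕ) (x p q : ℝ) :
    fderiv ℝ (duffingField a l d r k) (0, circleConst (x, 0)) (0, circleConst (p, q)) =
      (-circleSin * (-(3 * a * x ^ 2) • (circleCos ^ 2 * (p • circleCos + q • circleSin))
        - (5 * l * x ^ 4) • (circleCos ^ 4 * (p • circleCos + q • circleSin))),
        circleCos * (-(3 * a * x ^ 2) • (circleCos ^ 2 * (p • circleCos + q • circleSin))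
        - (5 * l * x ^ 4) • (circleCos ^ 4 * (p • circleCos + q • circleSin)))) := by
  set g := -(3 * a * x ^ 2) • (circleCos ^ 2 * (p • circleCos + q • circleSin))
        - (5 * l * x ^ 4) • (circleCos ^ 4 * (p • circleCos + q • circleSin))
  set X : ℝ → C(AddCircle (2 * π), ℝ) :=
    fun τ => x • circleCos + τ • (p • circleCos + q • circleSin) with hX
  have hXd : HasDerivAt X (p • circleCos + q • circleSin) 0 := by
    simpa [hX] using ((hasDerivAt_id' (0 : ℝ)).smul_const (p • circleCos + q • circleSin)).const_add
      (x • circleCos)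
  have hX0 : X 0 = x • circleCos := by simp [hX]
  have hf : HasDerivAt (fun τ => -(a • X τ ^ 3) - l • X τ ^ 5 + d • circleCos) g 0 := by
    refine (((((hXd.pow 3).const_smul a).neg.sub ((hXd.pow 5).const_smul l))).add_const
      (d • circleCos)).congr_deriv ?_
    rw [hX0]
    ext t
    have h3 : (3 : C(AddCircle (2 * π), ℝ)) t = 3 := rfl
    have h5 : (5 : C(AddCircle (2 * π), ℝ)) t = 5 := rfl
    simp [g, h3, h5]
    ring
  have hcurve : HasDerivAt (fun τ : ℝ => ((0 : ℝ), circleConst (x, 0) + τ • circleConst (p, q)))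
      (0, circleConst (p, q)) 0 :=
    (hasDerivAt_const _ _).prodMk (by
      simpa using ((hasDerivAt_id' (0 : ℝ)).smul_const (circleConst (p, q))).const_add
        (circleConst (x, 0)))
  have hG : HasFDerivAt (duffingField a l d r k)
      (fderiv ℝ (duffingField a l d r k) (0, circleConst (x, 0)))
      ((0 : ℝ), circleConst (x, 0) + (0 : ℝ) • circleConst (p, q)) := by
    rw [zero_smul, add_zero]
    exact ((contDiff_duffingField a l d r k).differentiable one_ne_zero _).hasFDerivAt
  refine (hG.comp_hasDerivAt (0 : ℝ) hcurve).unique ?_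
  have := (hf.const_mul (-circleSin)).prodMk (hf.const_mul circleCos)
  refine this.congr_of_eventuallyEq (Eventually.of_forall fun τ => ?_)
  have : duffingForce a l d r k ((0 : ℝ), circleConst (x, 0) + τ • circleConst (p, q)) =
      -(a • X τ ^ 3) - l • X τ ^ 5 + d • circleCos := by
    ext t
    simp [duffingForce, circleConst_apply, hX]
    ring
  simp only [Function.comp, duffingField, this]

theorem periodIntegral_fderiv_duffingField (a l d r : ℝ) (k : ℕ) (x p q : ℝ) :
    (AddCircle.periodIntegral (2 * π)).prodMap (AddCircle.periodIntegral (2 * π))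
      (fderiv ℝ (duffingField a l d r k) (0, circleConst (x, 0)) (0, circleConst (p, q))) =
      (π / 8 * (6 * a * x ^ 2 + 5 * l * x ^ 4) * q,
        -(π / 8 * (18 * a * x ^ 2 + 25 * l * x ^ 4) * p)) := by
  rw [fderiv_duffingField]
  refine Prod.ext ?_ ?_
  · change AddCircle.periodIntegral (2 * π) (-circleSin * _) = _
    rw [AddCircle.periodIntegral_apply]
    convert integral_even_cos_add_sin_mul_odd_cos (3 * a * x ^ 2 * q)
      ((5 * l * x ^ 4 - 3 * a * x ^ 2) * q) (-(5 * l * x ^ 4) * q)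
      0 (3 * a * x ^ 2 * p) (5 * l * x ^ 4 * p) using 1
    · congr 1
      ext t
      simp [circleCos_coe, circleSin_coe]
      linear_combination (3 * a * x ^ 2 * q * cos t ^ 2 + 5 * l * x ^ 4 * q * cos t ^ 4) * sin_sq t
    · ring
  · change AddCircle.periodIntegral (2 * π) (circleCos * _) = _
    rw [AddCircle.periodIntegral_apply]
    convert integral_even_cos_add_sin_mul_odd_cos 0 (-(3 * a * x ^ 2) * p) (-(5 * l * x ^ 4) * p)
      0 (-(3 * a * x ^ 2) * q) (-(5 * l * x ^ 4) * q) using 1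
    · congr 1
      ext t
      simp [circleCos_coe, circleSin_coe]
      ring
    · ring

/-- `(x, y)` is a `2π`-periodic solution of the rescaled extended Duffing–Van der Pol system. -/
def IsPeriodicDuffingSolution (a l d r : ℝ) (n₁ : ℤ) (ε : ℝ) (x y : ℝ → ℝ) : Prop :=
  (∀ t, HasDerivAt x (y t) t) ∧
  (∀ t, HasDerivAt y
    (-(x t) + ε ^ n₁ * r * y t - ε ^ n₁ * r * (x t) ^ 2 * y t
      - ε * a * (x t) ^ 3 - ε * l * (x t) ^ 5 + ε * d * Real.cos t) t) ∧
  (∀ t, x (t + 2 * Real.pi) = x t) ∧ (∀ t, y (t + 2 * Real.pi) = y t)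

theorem isPeriodicDuffingSolution_of_rotating {a l d r : ℝ} {k : ℕ} {ε : ℝ}
    {u v : C(AddCircle (2 * π), ℝ)}
    (hu : ∀ t : ℝ, HasDerivAt (fun t : ℝ => u t)
      (ε * (-circleSin * duffingForce a l d r k (ε, u, v)) t) t)
    (hv : ∀ t : ℝ, HasDerivAt (fun t : ℝ => v t)
      (ε * (circleCos * duffingForce a l d r k (ε, u, v)) t) t) :
    IsPeriodicDuffingSolution a l d r (k + 2 : ℕ) ε
      (fun t => u t * cos t + v t * sin t) (fun t => v t * cos t - u t * sin t) := by
  refine ⟨fun t => ?_, fun t => ?_, fun t => ?_, fun t => ?_⟩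
  · refine (((hu t).mul (hasDerivAt_cos t)).add ((hv t).mul (hasDerivAt_sin t))).congr_deriv ?_
    simp only [ContinuousMap.mul_apply, ContinuousMap.neg_apply, circleCos_coe, circleSin_coe]
    ring
  · refine (((hv t).mul (hasDerivAt_cos t)).sub ((hu t).mul (hasDerivAt_sin t))).congr_deriv ?_
    simp only [ContinuousMap.mul_apply, ContinuousMap.neg_apply, circleCos_coe, circleSin_coe]
    have h := duffingForce_coe a l d r k ε u v t
    rw [zpow_natCast]
    linear_combination ε * duffingForce a l d r k (ε, u, v) t * sin_sq_add_cos_sq t + ε * h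
  · simp
  · simp

theorem exists_periodic_branch {a l d r : ℝ} {k : ℕ} {x : ℝ}
    (hx : 6 * a * x ^ 3 + 5 * l * x ^ 5 = 8 * d) (hd : d ≠ 0)
    (hx' : 18 * a * x ^ 2 + 25 * l * x ^ 4 ≠ 0) :
    ∃ X Y : ℝ → ℝ → ℝ,
      (∀ᶠ ε in 𝓝 0, IsPeriodicDuffingSolution a l d r (k + 2 : ℕ) ε (X ε) (Y ε)) ∧
      Tendsto (fun ε => (X ε 0, Y ε 0)) (𝓝 0) (𝓝 (x, 0)) := by
  have hh : 6 * a * x ^ 2 + 5 * l * x ^ 4 ≠ 0 := by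
    intro h
    apply hd
    linear_combination x * h / 8 - hx / 8
  set ev₁ : C(AddCircle (2 * π), ℝ) →L[ℝ] ℝ :=
    ContinuousMap.evalCLM ℝ ((0 : ℝ) : AddCircle (2 * π))
  set P := AddCircle.primitive (2 * π)
  set I := AddCircle.periodIntegral (2 * π)
  obtain ⟨φ, hφ, hsol⟩ := exists_branch_of_nondegenerate_zero circleConst (v₀ := (x, 0))
    (ev₁.prodMap ev₁) (I.prodMap I) (P.prodMap P)
    (fun v => by simp [circleConst_apply, ev₁])
    (fun f => Prod.ext (by simp [ev₁, P, AddCircle.primitive_coe, -QuotientAddGroup.mk_zero])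
      (by simp [ev₁, P, AddCircle.primitive_coe, -QuotientAddGroup.mk_zero]))
    ((contDiff_duffingField a l d r k).contDiffAt.hasStrictFDerivAt one_ne_zero)
    (periodIntegral_duffingField k hx)
    (fun ⟨p, q⟩ h => by
      rw [periodIntegral_fderiv_duffingField] at h
      simpa [hh, hx', pi_ne_zero, and_comm] using h)
  refine ⟨fun ε t => (φ ε).1 t * cos t + (φ ε).2 t * sin t,
    fun ε t => (φ ε).2 t * cos t - (φ ε).1 t * sin t, ?_, ?_⟩
  · filter_upwards [hsol] with ε ⟨hI, hε⟩
    have key : ∀ (w g : C(AddCircle (2 * π), ℝ)) (c : ℝ), I g = 0 →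
        w = algebraMap ℝ _ c + ε • P g → ∀ t : ℝ, HasDerivAt (fun t : ℝ => w t) (ε * g t) t := by
      intro w g c hg hw t
      rw [hw]
      exact ((AddCircle.hasDerivAt_primitive (2 * π) hg t).const_mul ε).const_add c
    exact isPeriodicDuffingSolution_of_rotating
      (key _ _ _ (congrArg Prod.fst hI) (congrArg Prod.fst hε))
      (key _ _ _ (congrArg Prod.snd hI) (congrArg Prod.snd hε))
  · have := ((ev₁.prodMap ev₁).continuous.tendsto _).comp hφ
    rw [show (ev₁.prodMap ev₁) (circleConst (x, 0)) = (x, 0) by simp [circleConst_apply, ev₁]]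
      at this
    exact this.congr fun ε => by simp [ev₁, Prod.ext_iff]

end Averaging
theorem F5_eq_zero_iff {a l d : ℝ} (hd : d ≠ 0) (w : ℝ × ℝ) :
    F5 a l d w = (0, 0) ↔ w.2 = 0 ∧ 6 * a * w.1 ^ 3 + 5 * l * w.1 ^ 5 = 8 * d := by
  obtain ⟨x, y⟩ := w
  simp only [F5, Prod.mk.injEq]
  constructor
  · rintro ⟨h1, h2⟩
    have hy : y = 0 := by
      by_contra hy
      have h3 : (x ^ 2 + y ^ 2) * (6 * a + 5 * l * (x ^ 2 + y ^ 2)) = 0 := by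
        rw [mul_assoc] at h1
        exact (mul_eq_zero.1 h1).resolve_left hy
      apply hd
      linear_combination h2 / 8 + x * h3 / 8
    subst hy
    exact ⟨rfl, by linear_combination -h2⟩
  · rintro ⟨rfl, h⟩
    exact ⟨by ring, by linear_combination -h⟩

theorem hasDerivAt_five_cube_sub_three_pow_five (x : ℝ) :
    HasDerivAt (fun x : ℝ => 5 * x ^ 3 - 3 * x ^ 5) (15 * x ^ 2 * (1 - x ^ 2)) x := by
  refine (((hasDerivAt_pow 3 x).const_mul 5).sub ((hasDerivAt_pow 5 x).const_mul 3)).congr_deriv ?_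
  norm_num
  ring

theorem exists_root_lt_neg_one {κ : ℝ} (h0 : 0 < κ) (h2 : κ ≤ 2) :
    ∃ x < -1, 5 * x ^ 3 - 3 * x ^ 5 = κ := by
  obtain ⟨x, hx, h⟩ := intermediate_value_Icc' (f := fun x : ℝ => 5 * x ^ 3 - 3 * x ^ 5)
    (a := -2) (b := -1) (by norm_num) (by fun_prop)
    (show κ ∈ _ by constructor <;> norm_num <;> linarith)
  refine ⟨x, lt_of_le_of_ne hx.2 ?_, h⟩
  rintro rfl
  norm_num at h
  linarith

theorem exists_three_roots {κ : ℝ} (h0 : 0 < κ) (h2 : κ < 2) :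
    ∃ x : Fin 3 → ℝ, Function.Injective x ∧ (∀ i, 5 * x i ^ 3 - 3 * x i ^ 5 = κ) ∧
      ∀ w, 5 * w ^ 3 - 3 * w ^ 5 = κ → ∃ i, w = x i := by
  set q : ℝ → ℝ := fun x => 5 * x ^ 3 - 3 * x ^ 5 with hq
  have hqc : Continuous q := by fun_prop
  have hd : ∀ x, deriv q x = 15 * x ^ 2 * (1 - x ^ 2) := fun x =>
    (hasDerivAt_five_cube_sub_three_pow_five x).deriv
  have hanti1 : StrictAntiOn q (Set.Iic (-1)) := by
    refine strictAntiOn_of_deriv_neg (convex_Iic _) hqc.continuousOn fun x hx => ?_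
    rw [interior_Iic, Set.mem_Iio] at hx
    rw [hd]
    exact mul_neg_of_pos_of_neg (by nlinarith) (by nlinarith)
  have hmono : StrictMonoOn q (Set.Icc 0 1) := by
    refine strictMonoOn_of_deriv_pos (convex_Icc _ _) hqc.continuousOn fun x hx => ?_
    rw [interior_Icc, Set.mem_Ioo] at hx
    rw [hd]
    exact mul_pos (by nlinarith) (by nlinarith)
  have hanti2 : StrictAntiOn q (Set.Ici 1) := by
    refine strictAntiOn_of_deriv_neg (convex_Ici _) hqc.continuousOn fun x hx => ?_
    rw [interior_Ici, Set.mem_Ioi] at hx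
    rw [hd]
    exact mul_neg_of_pos_of_neg (by nlinarith) (by nlinarith)
  obtain ⟨x₀, hx₀, e₀⟩ := exists_root_lt_neg_one h0 h2.le
  obtain ⟨x₁, hx₁, e₁⟩ := intermediate_value_Icc (f := q) (a := 0) (b := 1) (by norm_num)
    hqc.continuousOn (show κ ∈ _ by constructor <;> norm_num [hq] <;> linarith)
  obtain ⟨x₂, hx₂, e₂⟩ := intermediate_value_Icc' (f := q) (a := 1) (b := 2) (by norm_num)
    hqc.continuousOn (show κ ∈ _ by constructor <;> norm_num [hq] <;> linarith)
  have h12 : x₁ < x₂ := by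
    refine lt_of_le_of_ne (hx₁.2.trans hx₂.1) ?_
    rintro rfl
    have : x₁ = 1 := le_antisymm hx₁.2 hx₂.1
    subst this
    norm_num [hq] at e₁
    linarith
  have h01 : x₀ < x₁ := by linarith [hx₁.1]
  refine ⟨![x₀, x₁, x₂], ?_, ?_, ?_⟩
  · refine StrictMono.injective (Fin.strictMono_iff_lt_succ.2 fun i => ?_)
    fin_cases i
    · exact h01
    · exact h12
  · intro i
    fin_cases i
    exacts [e₀, e₁, e₂]
  · intro w hw
    rcases le_or_gt w (-1) with h | h
    · exact ⟨0, hanti1.injOn h hx₀.le (hw.trans e₀.symm)⟩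
    rcases le_or_gt w 0 with h' | h'
    · nlinarith [pow_nonneg (neg_nonneg.2 h') 3, mul_nonneg (pow_nonneg (neg_nonneg.2 h') 3)
        (show 0 ≤ 5 - 3 * w ^ 2 by nlinarith)]
    rcases le_or_gt w 1 with h'' | h''
    · exact ⟨1, hmono.injOn ⟨h'.le, h''⟩ hx₁ (hw.trans e₁.symm)⟩
    · exact ⟨2, hanti2.injOn h''.le hx₂.1 (hw.trans e₂.symm)⟩

/-- The substitution `x = s ξ` bringing the quintic `6 a x³ + 5 l x⁵ = 8 d` to the normal form
`5 ξ³ - 3 ξ⁵ = κ`, together with the meaning of the sign of `D5` for `κ`. -/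
theorem exists_scaling {a l d : ℝ} (hal : a * l < 0) (hd : 0 < d) :
    ∃ s κ : ℝ, s ≠ 0 ∧ 0 < κ ∧ (D5 a l d = 0 → κ = 2) ∧ (D5 a l d < 0 → κ < 2) ∧
      (∀ x, 6 * a * (s * x) ^ 3 + 5 * l * (s * x) ^ 5 = 8 * d ↔ 5 * x ^ 3 - 3 * x ^ 5 = κ) ∧
      ∀ x, 18 * a * (s * x) ^ 2 + 25 * l * (s * x) ^ 4 =
        18 * a * s ^ 2 * (x ^ 2 * (1 - x ^ 2)) := by
  have ha : a ≠ 0 := by rintro rfl; simp at hal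
  have hl : l ≠ 0 := by rintro rfl; simp at hal
  obtain ⟨s, hs2, has⟩ : ∃ s : ℝ, 25 * l * s ^ 2 = -18 * a ∧ 0 < a * s := by
    have hpos : 0 < -18 * a / (25 * l) := by
      have : -18 * a / (25 * l) = -18 * (a * l) / (25 * l ^ 2) := by field_simp
      rw [this]
      have := sq_pos_of_ne_zero hl
      apply div_pos <;> linarith
    have hsq := Real.sq_sqrt hpos.le
    have hs := Real.sqrt_pos.2 hpos
    set s := √(-18 * a / (25 * l))
    have h25 : 25 * l * s ^ 2 = -18 * a := by rw [hsq]; field_simp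
    rcases lt_or_gt_of_ne ha with h | h
    · exact ⟨-s, by linear_combination h25, by nlinarith⟩
    · exact ⟨s, h25, by positivity⟩
  have hs : s ≠ 0 := by rintro rfl; simp at has
  have has3 : 0 < a * s ^ 3 := by
    have := sq_pos_of_ne_zero hs
    nlinarith [mul_pos has this]
  set κ := 20 * d / (3 * (a * s ^ 3)) with hκ
  have hκ0 : 0 < κ := by positivity
  have hκd : 3 * κ * (a * s ^ 3) = 20 * d := by rw [hκ]; field_simp
  have hD : D5 a l d = 1280 * d ^ 2 / l ^ 4 * ((9 / 25) * (a * s ^ 3) ^ 2) * (κ ^ 2 - 4) := by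
    have h6 : s ^ 6 = (-18 * a) ^ 3 / (25 * l) ^ 3 := by rw [← hs2]; field_simp
    have : (9 / 25) * (a * s ^ 3) ^ 2 * (κ ^ 2 - 4) =
        16 * d ^ 2 - 36 / 25 * a ^ 2 * s ^ 6 := by
      linear_combination (1 / 25) * (3 * κ * (a * s ^ 3) + 20 * d) * hκd
    rw [mul_assoc, this, h6, D5]
    field_simp
    ring
  have hC : 0 < 1280 * d ^ 2 / l ^ 4 * ((9 / 25) * (a * s ^ 3) ^ 2) := by
    have : 0 < l ^ 4 := by positivity
    positivity
  refine ⟨s, κ, hs, hκ0, fun h => ?_, fun h => ?_, fun x => ?_, fun x => ?_⟩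
  · rw [hD] at h
    have := (mul_eq_zero.1 h).resolve_left hC.ne'
    nlinarith
  · rw [hD] at h
    have := neg_of_mul_neg_right h hC.le
    nlinarith
  · have h1 : 6 * a * (s * x) ^ 3 + 5 * l * (s * x) ^ 5 - 8 * d =
        6 / 5 * (a * s ^ 3) * (5 * x ^ 3 - 3 * x ^ 5 - κ) := by
      linear_combination s ^ 3 * x ^ 5 / 5 * hs2 + 2 / 5 * hκd
    rw [← sub_eq_zero, h1, ← sub_eq_zero (b := κ)]
    simp [has3.ne']
  · linear_combination s ^ 2 * x ^ 4 * hs2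

/-- Three branches with distinct limits exist and stay distinct on a common interval of `ε`. -/
theorem exists_common_interval_of_branches {a l d r : ℝ} {n₁ : ℤ} {z : Fin 3 → ℝ × ℝ}
    (hz : Function.Injective z) {X Y : Fin 3 → ℝ → ℝ → ℝ}
    (hsol : ∀ i, ∀ᶠ ε in 𝓝 0, IsPeriodicDuffingSolution a l d r n₁ ε (X i ε) (Y i ε))
    (hlim : ∀ i, Tendsto (fun ε => (X i ε 0, Y i ε 0)) (𝓝 0) (𝓝 (z i))) :
    ∃ ε₀ > (0 : ℝ), ∀ ε ∈ Set.Ioo 0 ε₀,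
      (∀ i, IsPeriodicDuffingSolution a l d r n₁ ε (X i ε) (Y i ε)) ∧
      ∀ i j, i ≠ j → (X i ε 0, Y i ε 0) ≠ (X j ε 0, Y j ε 0) := by
  have hne : ∀ᶠ ε in 𝓝 0, ∀ i j, i ≠ j → (X i ε 0, Y i ε 0) ≠ (X j ε 0, Y j ε 0) := by
    refine eventually_all.2 fun i => eventually_all.2 fun j => ?_
    by_cases hij : i = j
    · simp [hij]
    · filter_upwards [((hlim i).prodMk_nhds (hlim j)).eventually
        (isClosed_diagonal.isOpen_compl.mem_nhds (hz.ne hij))] with ε h _ using h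
  obtain ⟨ε₀, h0, h⟩ := Metric.eventually_nhds_iff.1 ((eventually_all.2 hsol).and hne)
  refine ⟨ε₀, h0, fun ε hε => h ?_⟩
  rw [Real.dist_eq, sub_zero, abs_of_pos hε.1]
  exact hε.2

/-- Theorem 5 of the paper.
For `(α, λ, δ, ρ) = (εa, εℓ, εd, ε^{n₁}r)` with `n₁ > 1` and `aℓ < 0`: if `D = 0`
the system has at least one `2π`-periodic solution for every small `ε > 0`; if
`D < 0` it has at least three distinct ones, whose initial conditions converge
to the three distinct real zeros of `F5`.  Both alternatives are realizable. -/
theorem stmt_4 (a l d r : ℝ) (n₁ : ℤ)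
    (hal : a * l < 0) (hl : l ≠ 0) (hd : 0 < d) (hn₁ : 1 < n₁) (hr : 0 ≤ r) :
    (D5 a l d = 0 →
      ∃ ε₀ > (0 : ℝ), ∀ ε ∈ Set.Ioo (0 : ℝ) ε₀, ∃ x y : ℝ → ℝ,
        (∀ t, HasDerivAt x (y t) t) ∧
        (∀ t, HasDerivAt y
          (-(x t) + ε ^ n₁ * r * y t - ε ^ n₁ * r * (x t) ^ 2 * y t
            - ε * a * (x t) ^ 3 - ε * l * (x t) ^ 5 + ε * d * Real.cos t) t) ∧
        (∀ t, x (t + 2 * Real.pi) = x t) ∧ (∀ t, y (t + 2 * Real.pi) = y t)) ∧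
    (D5 a l d < 0 →
      ∃ z : Fin 3 → ℝ × ℝ, Function.Injective z ∧
        (∀ i, F5 a l d (z i) = (0, 0)) ∧
        (∀ w, F5 a l d w = (0, 0) → ∃ i, w = z i) ∧
        ∃ ε₀ > (0 : ℝ), ∃ X Y : Fin 3 → ℝ → ℝ → ℝ,
          (∀ i, ∀ ε ∈ Set.Ioo (0 : ℝ) ε₀,
            (∀ t, HasDerivAt (X i ε) (Y i ε t) t) ∧
            (∀ t, HasDerivAt (Y i ε)
              (-(X i ε t) + ε ^ n₁ * r * Y i ε t
                - ε ^ n₁ * r * (X i ε t) ^ 2 * Y i ε t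
                - ε * a * (X i ε t) ^ 3 - ε * l * (X i ε t) ^ 5
                + ε * d * Real.cos t) t) ∧
            (∀ t, X i ε (t + 2 * Real.pi) = X i ε t) ∧
            (∀ t, Y i ε (t + 2 * Real.pi) = Y i ε t)) ∧
          (∀ ε ∈ Set.Ioo (0 : ℝ) ε₀, ∀ i j, i ≠ j →
            (X i ε 0, Y i ε 0) ≠ (X j ε 0, Y j ε 0)) ∧
          (∀ i, Filter.Tendsto (fun ε => (X i ε 0, Y i ε 0))
            (nhdsWithin 0 (Set.Ioi 0)) (nhds (z i)))) ∧
    (∃ a' l' d' : ℝ, a' * l' < 0 ∧ 0 < d' ∧ D5 a' l' d' = 0) ∧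
    (∃ a' l' d' : ℝ, a' * l' < 0 ∧ 0 < d' ∧ D5 a' l' d' < 0) := by
  have ha : a ≠ 0 := by rintro rfl; simp at hal
  obtain ⟨k, rfl⟩ : ∃ k : ℕ, n₁ = (k + 2 : ℕ) := ⟨(n₁ - 2).toNat, by omega⟩
  obtain ⟨s, κ, hs, hκ, hκeq, hκlt, hroot, hderiv⟩ := exists_scaling hal hd
  have hbranch : ∀ ξ, 5 * ξ ^ 3 - 3 * ξ ^ 5 = κ → ξ ≠ 1 → κ ≤ 2 → ∃ X Y : ℝ → ℝ → ℝ,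
      (∀ᶠ ε in 𝓝 0, IsPeriodicDuffingSolution a l d r (k + 2 : ℕ) ε (X ε) (Y ε)) ∧
      Tendsto (fun ε => (X ε 0, Y ε 0)) (𝓝 0) (𝓝 (s * ξ, 0)) := by
    intro ξ hξ h1 hκ2
    refine exists_periodic_branch ((hroot ξ).2 hξ) hd.ne' ?_
    rw [hderiv]
    have h0 : ξ ≠ 0 := by rintro rfl; norm_num at hξ; linarith
    have hm1 : ξ ≠ -1 := by rintro rfl; norm_num at hξ; linarith
    have : 1 - ξ ^ 2 ≠ 0 := by
      rw [show 1 - ξ ^ 2 = (1 - ξ) * (ξ - -1) by ring]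
      exact mul_ne_zero (sub_ne_zero.2 h1.symm) (sub_ne_zero.2 hm1)
    positivity
  refine ⟨fun hD => ?_, fun hD => ?_, ⟨25, -18, 15 / 2, by norm_num, by norm_num, by norm_num [D5]⟩,
    ⟨25, -18, 1, by norm_num, by norm_num, by norm_num [D5]⟩⟩
  · have hκ2 := (hκeq hD).le
    obtain ⟨ξ, hξ1, hξ⟩ := exists_root_lt_neg_one hκ hκ2
    obtain ⟨X, Y, hsol, -⟩ := hbranch ξ hξ (by linarith) hκ2
    obtain ⟨ε₀, h0, h⟩ := Metric.eventually_nhds_iff.1 hsol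
    refine ⟨ε₀, h0, fun ε hε => ⟨X ε, Y ε, h ?_⟩⟩
    rw [Real.dist_eq, sub_zero, abs_of_pos hε.1]
    exact hε.2
  · have hκ2 := hκlt hD
    obtain ⟨ξ, hinj, hξ, hall⟩ := exists_three_roots hκ hκ2
    have hξ1 : ∀ i, ξ i ≠ 1 := fun i h => by
      have := hξ i
      rw [h] at this
      linarith
    choose X Y hsol hlim using fun i => hbranch (ξ i) (hξ i) (hξ1 i) hκ2.le
    have hz : Function.Injective fun i => (s * ξ i, (0 : ℝ)) := fun i j h =>
      hinj (mul_left_cancel₀ hs (congrArg Prod.fst h))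
    obtain ⟨ε₀, h0, h⟩ := exists_common_interval_of_branches hz hsol hlim
    refine ⟨_, hz, fun i => (F5_eq_zero_iff hd.ne' _).2 ⟨rfl, (hroot _).2 (hξ i)⟩, fun w hw => ?_,
      ε₀, h0, X, Y, fun i ε hε => (h ε hε).1 i, fun ε hε => (h ε hε).2,
      fun i => (hlim i).mono_left nhdsWithin_le_nhds⟩
    obtain ⟨hw2, hw1⟩ := (F5_eq_zero_iff hd.ne' w).1 hw
    have hws : s * (w.1 / s) = w.1 := mul_div_cancel₀ _ hs
    rw [← hws] at hw1
    obtain ⟨i, hi⟩ := hall _ ((hroot _).1 hw1)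
    exact ⟨i, Prod.ext (by rw [← hi, hws]) hw2⟩
end

section
/- Let r > 0, a, d > 0 be real with −324a⁴r² − 9a²d²r² + 36a²r⁴ − d²r⁴ ≠ 0, let n₃ > 1 be an integer and ℓ ≠ 0 real. Set Δ₁ = 324a⁴ + d²r² + 9a²(d² − 4r²) and Δ₂ = 2187a⁴d⁴ + 27d⁴r⁴ − 16d²r⁶ + 18a²(27d⁴r² − 72d²r⁴ + 32r⁶). Then the algebraic system rx₀(−4 + x₀² + y₀²) − 3a y₀(x₀² + y₀²) = 0, 4d − r y₀(−4 + x₀² + y₀²) − 3a x₀(x₀² + y₀²) = 0 has exactly one real solution (x₀⁰, y₀⁰) if Δ₁Δ₂ = 0 or Δ₂ > 0, and exactly three real solutions (x₀ⁱ, y₀ⁱ), i = 1,2,3, if Δ₂ < 0. Assuming in addition that each solution satisfies 27a²((x₀ⁱ)² + (y₀ⁱ)²)² + r²(−4 + (x₀ⁱ)² + (y₀ⁱ)²)(−4 + 3(x₀ⁱ)² + 3(y₀ⁱ)²) ≠ 0, there exists ε₀ > 0 such that for every ε ∈ (0, ε₀) the system ẋ = y, ẏ = −x + εr y − εr x² y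 − εa x³ − ε^{n₃} ℓ x⁵ + εd cos t has, correspondingly, one (respectively three distinct) 2π-periodic solutions whose initial conditions converge to the respective solutions (x₀ⁱ, y₀ⁱ) as ε → 0⁺. Moreover there exist values of r, a, d realizing each alternative. -/
/-- `Δ₁` of Theorem 6 of the paper. -/
noncomputable def delta1 (a d r : ℝ) : ℝ :=
  324 * a ^ 4 + d ^ 2 * r ^ 2 + 9 * a ^ 2 * (d ^ 2 - 4 * r ^ 2)

/-- `Δ₂` of Theorem 6 of the paper. -/
noncomputable def delta2 (a d r : ℝ) : ℝ :=
  2187 * a ^ 4 * d ^ 4 + 27 * d ^ 4 * r ^ 4 - 16 * d ^ 2 * r ^ 6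
    + 18 * a ^ 2 * (27 * d ^ 4 * r ^ 2 - 72 * d ^ 2 * r ^ 4 + 32 * r ^ 6)

/-- The algebraic system of Theorem 6 of the paper. -/
def sys6 (r a d : ℝ) (z : ℝ × ℝ) : Prop :=
  r * z.1 * (-4 + z.1 ^ 2 + z.2 ^ 2) - 3 * a * z.2 * (z.1 ^ 2 + z.2 ^ 2) = 0 ∧
  4 * d - r * z.2 * (-4 + z.1 ^ 2 + z.2 ^ 2) - 3 * a * z.1 * (z.1 ^ 2 + z.2 ^ 2) = 0

open Filter Topology

/-- A Lyapunov–Schmidt reduction. The map `c` embeds the constants, `e` evaluates at a base point,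
`I` is the average and `P` the primitive vanishing at the base point. If the averaged map has a
nondegenerate zero at `z`, then the constant `c z` continues to a branch of solutions. -/
theorem exists_branch_of_bijective_average {E V : Type*}
    [NormedAddCommGroup E] [NormedSpace ℝ E] [CompleteSpace E]
    [NormedAddCommGroup V] [NormedSpace ℝ V]
    (c : V →L[ℝ] E) (e I : E →L[ℝ] V) (P : E →L[ℝ] E)
    (hec : ∀ v, e (c v) = v) (heP : ∀ x, e (P x) = 0)
    {G : ℝ × E → E} {z : V} {D : E →L[ℝ] E} (hG : ContDiffAt ℝ 1 G (0, c z))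
    (hD : HasFDerivAt (fun w => G (0, w)) D (c z)) (hI : I (G (0, c z)) = 0)
    (hJ : Function.Bijective fun v => I (D (c v))) :
    ∃ w : ℝ → E, Tendsto w (𝓝 0) (𝓝 (c z)) ∧
      ∀ᶠ ε in 𝓝 0, I (G (ε, w ε)) = 0 ∧ w ε = c (e (w ε)) + ε • P (G (ε, w ε)) := by
  let H : ℝ × E → E := fun p => p.2 - c (e p.2) - p.1 • P (G p) + c (I (G p))
  have hH : ContDiffAt ℝ 1 H (0, c z) := by
    have h1 : ContDiffAt ℝ 1 (fun p => P (G p)) (0, c z) := P.contDiff.contDiffAt.comp _ hG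
    have h2 : ContDiffAt ℝ 1 (fun p => c (I (G p))) (0, c z) :=
      (c ∘L I).contDiff.contDiffAt.comp _ hG
    have h3 : ContDiffAt ℝ 1 (fun p : ℝ × E => c (e p.2)) (0, c z) :=
      (c ∘L e ∘L ContinuousLinearMap.snd ℝ ℝ E).contDiff.contDiffAt
    exact ((contDiffAt_snd.sub h3).sub (contDiffAt_fst.smul h1)).add h2
  have hstrict := hH.hasStrictFDerivAt one_ne_zero
  set H' := fderiv ℝ H (0, c z)
  let L : E →L[ℝ] E := .id ℝ E - c ∘L e + c ∘L I ∘L D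
  have hL : ∀ h, L h = h - c (e h) + c (I (D h)) := fun h => rfl
  have hpartial : H' ∘L .inr ℝ ℝ E = L := by
    have hcomp : HasFDerivAt (fun w => H (0, w)) (H' ∘L .inr ℝ ℝ E) (c z) :=
      HasFDerivAt.comp (c z) (f := fun w : E => ((0 : ℝ), w)) hstrict.hasFDerivAt
        (hasFDerivAt_prodMk_right 0 (c z))
    have hexp : HasFDerivAt (fun w => H (0, w)) L (c z) := by
      have h0 : HasFDerivAt (fun w => w - c (e w) + c (I (G (0, w)))) L (c z) :=
        ((hasFDerivAt_id (c z)).sub (c ∘L e).hasFDerivAt).add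
          ((c ∘L I).hasFDerivAt.comp (c z) hD)
      convert h0 using 2 with w
      simp [H]
    exact hcomp.unique hexp
  have hinj : Function.Injective L := by
    refine (injective_iff_map_eq_zero L).2 fun h h0 => ?_
    have h1 : I (D h) = 0 := by simpa [hL, hec] using congrArg e h0
    have h2 : h = c (e h) := by
      rw [hL, h1, map_zero, add_zero] at h0
      exact sub_eq_zero.1 h0
    have h3 : e h = 0 := hJ.1 (by simpa [← h2] using h1)
    rw [h2, h3, map_zero]
  have hsurj : Function.Surjective L := by
    intro k
    obtain ⟨v, hv⟩ := hJ.2 (e k - I (D (k - c (e k))))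
    refine ⟨c v + (k - c (e k)), ?_⟩
    have h1 : I (D (c v + (k - c (e k)))) = e k := by
      rw [map_add D, map_add I]
      exact eq_sub_iff_add_eq.1 hv
    rw [hL, h1]
    simp [hec]
  have hinv : (H' ∘L .inr ℝ ℝ E).IsInvertible := by
    rw [hpartial]
    exact ⟨ContinuousLinearEquiv.ofBijective L (LinearMap.ker_eq_bot.2 hinj)
      (LinearMap.range_eq_top.2 hsurj), by ext; simp⟩
  refine ⟨hstrict.implicitFunctionOfProdDomain hinv,
    hstrict.tendsto_implicitFunctionOfProdDomain hinv, ?_⟩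
  filter_upwards [hstrict.eventually_apply_implicitFunctionOfProdDomain hinv] with ε hε
  set w := hstrict.implicitFunctionOfProdDomain hinv ε
  have hzero : w - c (e w) - ε • P (G (ε, w)) + c (I (G (ε, w))) = 0 := by
    have : H (ε, w) = 0 := by
      rw [hε]
      simp [H, hec, hI]
    exact this
  have h1 : I (G (ε, w)) = 0 := by simpa [hec, heP] using congrArg e hzero
  refine ⟨h1, ?_⟩
  rw [h1, map_zero, add_zero, sub_sub] at hzero
  exact sub_eq_zero.1 hzero

instance fact_two_pi_pos : Fact (0 < 2 * Real.pi) := ⟨Real.two_pi_pos⟩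

/-- Continuous `2π`-periodic functions. -/
abbrev PeriodicFun := C(AddCircle (2 * Real.pi), ℝ)

namespace PeriodicFun

theorem continuous_coe (f : PeriodicFun) : Continuous fun t : ℝ => f t :=
  f.continuous.comp (AddCircle.continuous_mk' _)

theorem periodic_coe (f : PeriodicFun) : Function.Periodic (fun t : ℝ => f t) (2 * Real.pi) :=
  fun t => by simp

theorem intervalIntegrable_coe (f : PeriodicFun) (s t : ℝ) :
    IntervalIntegrable (fun x : ℝ => f x) MeasureTheory.volume s t :=
  f.continuous_coe.intervalIntegrable s t

theorem norm_integral_le (f : PeriodicFun) (t : ℝ) : ‖∫ x in (0 : ℝ)..t, f x‖ ≤ ‖f‖ * |t| := by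
  simpa using intervalIntegral.norm_integral_le_of_norm_le_const (a := 0) (b := t)
    (f := fun x : ℝ => f x) fun x _ => f.norm_coe_le_norm x

/-- The integral over a period. -/
noncomputable def periodIntegral : PeriodicFun →L[ℝ] ℝ :=
  LinearMap.mkContinuous
    { toFun := fun f => ∫ x in (0 : ℝ)..2 * Real.pi, f x
      map_add' := fun f g => intervalIntegral.integral_add (f.intervalIntegrable_coe _ _)
        (g.intervalIntegrable_coe _ _)
      map_smul' := fun k f => intervalIntegral.integral_const_mul k _ }
    (2 * Real.pi) fun f => by
      simpa [abs_of_pos Real.pi_pos, mul_comm] using f.norm_integral_le (2 * Real.pi)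

theorem periodIntegral_apply (f : PeriodicFun) :
    periodIntegral f = ∫ x in (0 : ℝ)..2 * Real.pi, f x := rfl

/-- The primitive, vanishing at `0`, of `f` minus its mean. -/
noncomputable def primitiveFun (f : PeriodicFun) (t : ℝ) : ℝ :=
  (∫ x in (0 : ℝ)..t, f x) - t / (2 * Real.pi) * periodIntegral f

theorem primitiveFun_periodic (f : PeriodicFun) :
    Function.Periodic f.primitiveFun (2 * Real.pi) := by
  intro t
  have h := intervalIntegral.integral_add_adjacent_intervals
    (f.intervalIntegrable_coe 0 t) (f.intervalIntegrable_coe t (t + 2 * Real.pi))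
  rw [f.periodic_coe.intervalIntegral_add_eq t 0, zero_add] at h
  have hpi := Real.pi_pos.ne'
  rw [primitiveFun, primitiveFun, ← h, ← periodIntegral_apply]
  field_simp
  ring

theorem primitiveFun_continuous (f : PeriodicFun) : Continuous f.primitiveFun := by
  have h := intervalIntegral.continuous_primitive (fun a b => f.intervalIntegrable_coe a b) 0
  exact h.sub (by fun_prop)

/-- `primitiveFun` as a bounded operator on periodic functions. -/
noncomputable def primitive : PeriodicFun →L[ℝ] PeriodicFun :=
  LinearMap.mkContinuous
    { toFun := fun f =>
        ⟨f.primitiveFun_periodic.lift, continuous_quot_lift _ f.primitiveFun_continuous⟩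
      map_add' := fun f g => by
        ext x
        induction x using QuotientAddGroup.induction_on with | _ t
        have h := intervalIntegral.integral_add (f.intervalIntegrable_coe 0 t)
          (g.intervalIntegrable_coe 0 t)
        change primitiveFun (f + g) t = primitiveFun f t + primitiveFun g t
        simp only [primitiveFun, ContinuousMap.add_apply, map_add, h]
        ring
      map_smul' := fun k f => by
        ext x
        induction x using QuotientAddGroup.induction_on with | _ t
        change primitiveFun (k • f) t = k * primitiveFun f t
        simp only [primitiveFun, ContinuousMap.smul_apply, map_smul, smul_eq_mul,
          intervalIntegral.integral_const_mul]
        ring }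
    (4 * Real.pi) fun f => by
      have hpi := Real.pi_pos
      refine (ContinuousMap.norm_le _ (by positivity)).2 fun x => ?_
      obtain ⟨t, ⟨ht0, ht1⟩, rfl⟩ :=
        (AddCircle.coe_image_Ico_eq (2 * Real.pi) 0).ge (Set.mem_univ x)
      rw [zero_add] at ht1
      have h1 : ‖∫ x in (0 : ℝ)..t, f x‖ ≤ ‖f‖ * (2 * Real.pi) :=
        (f.norm_integral_le t).trans (by rw [abs_of_nonneg ht0]; gcongr)
      have h2 : ‖t / (2 * Real.pi) * periodIntegral f‖ ≤ 1 * (‖f‖ * (2 * Real.pi)) := by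
        rw [norm_mul]
        gcongr
        · rw [Real.norm_of_nonneg (by positivity)]
          exact (div_le_one (by positivity)).2 ht1.le
        · simpa [periodIntegral_apply, abs_of_pos hpi] using f.norm_integral_le (2 * Real.pi)
      change ‖(∫ x in (0 : ℝ)..t, f x) - t / (2 * Real.pi) * periodIntegral f‖ ≤ _
      refine (norm_sub_le _ _).trans ((add_le_add h1 h2).trans_eq ?_)
      ring

theorem primitive_coe (f : PeriodicFun) (t : ℝ) : primitive f t = f.primitiveFun t := rfl

theorem primitive_zero (f : PeriodicFun) : primitive f 0 = 0 := by
  have h := f.primitive_coe 0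
  simpa [primitiveFun] using h

theorem hasDerivAt_primitive {f : PeriodicFun} (hf : periodIntegral f = 0) (t : ℝ) :
    HasDerivAt (fun s : ℝ => primitive f s) (f t) t := by
  simp only [primitive_coe, primitiveFun, hf, mul_zero, sub_zero]
  exact intervalIntegral.integral_hasDerivAt_right (f.intervalIntegrable_coe 0 t)
    f.continuous_coe.aestronglyMeasurable.stronglyMeasurableAtFilter f.continuous_coe.continuousAt

/-- The cosine as a periodic function. -/
noncomputable def cosFun : PeriodicFun :=
  ⟨Real.cos_periodic.lift, continuous_quot_lift _ Real.continuous_cos⟩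

/-- The sine as a periodic function. -/
noncomputable def sinFun : PeriodicFun :=
  ⟨Real.sin_periodic.lift, continuous_quot_lift _ Real.continuous_sin⟩

@[simp] theorem cosFun_coe (t : ℝ) : cosFun t = Real.cos t := rfl

@[simp] theorem sinFun_coe (t : ℝ) : sinFun t = Real.sin t := rfl

/-- The linear form `x cos + y sin`. -/
noncomputable def linForm (x y : ℝ) : PeriodicFun := x • cosFun + y • sinFun

theorem linForm_coe (x y t : ℝ) : linForm x y t = x * Real.cos t + y * Real.sin t := rfl

theorem periodIntegral_mul_linForm (x₁ y₁ x₂ y₂ : ℝ) :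
    periodIntegral (linForm x₁ y₁ * linForm x₂ y₂) = Real.pi * (x₁ * x₂ + y₁ * y₂) := by
  rw [periodIntegral_apply, intervalIntegral.integral_eq_sub_of_hasDerivAt
    (f := fun t => x₁ * x₂ * ((t + Real.sin t * Real.cos t) / 2)
      + y₁ * y₂ * ((t - Real.sin t * Real.cos t) / 2)
      + (x₁ * y₂ + y₁ * x₂) * (Real.sin t ^ 2 / 2)) (fun t _ => ?_)
    (intervalIntegrable_coe _ _ _)]
  · simp
    ring
  · have hs := Real.hasDerivAt_sin t
    have hc := Real.hasDerivAt_cos t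
    have hi := hasDerivAt_id t
    refine ((((hi.add (hs.mul hc)).div_const 2).const_mul (x₁ * x₂)).add
      (((hi.sub (hs.mul hc)).div_const 2).const_mul (y₁ * y₂)) |>.add
      (((hs.pow 2).div_const 2).const_mul (x₁ * y₂ + y₁ * x₂))).congr_deriv ?_
    simp only [ContinuousMap.coe_mul, Pi.mul_apply, linForm_coe]
    push_cast
    linear_combination -(x₁ * x₂ / 2 + y₁ * y₂ / 2) * Real.sin_sq_add_cos_sq t

theorem periodIntegral_mul_mul_mul_linForm (x₁ y₁ x₂ y₂ x₃ y₃ x₄ y₄ : ℝ) :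
    periodIntegral (linForm x₁ y₁ * linForm x₂ y₂ * linForm x₃ y₃ * linForm x₄ y₄) =
      Real.pi / 4 * ((x₁ * x₂ + y₁ * y₂) * (x₃ * x₄ + y₃ * y₄)
        + (x₁ * x₃ + y₁ * y₃) * (x₂ * x₄ + y₂ * y₄)
        + (x₁ * x₄ + y₁ * y₄) * (x₂ * x₃ + y₂ * y₃)) := by
  rw [periodIntegral_apply, intervalIntegral.integral_eq_sub_of_hasDerivAt
    (f := fun t => x₁ * x₂ * x₃ * x₄ *
        (3 / 8 * t + 3 / 8 * (Real.sin t * Real.cos t) + Real.cos t ^ 3 * Real.sin t / 4)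
      + y₁ * y₂ * y₃ * y₄ *
        (3 / 8 * t - 3 / 8 * (Real.sin t * Real.cos t) - Real.sin t ^ 3 * Real.cos t / 4)
      + (x₁ * x₂ * y₃ * y₄ + x₁ * y₂ * x₃ * y₄ + x₁ * y₂ * y₃ * x₄
          + y₁ * x₂ * x₃ * y₄ + y₁ * x₂ * y₃ * x₄ + y₁ * y₂ * x₃ * x₄) *
        (1 / 8 * t + 1 / 8 * (Real.sin t * Real.cos t) - Real.cos t ^ 3 * Real.sin t / 4)
      + (x₁ * x₂ * x₃ * y₄ + x₁ * x₂ * y₃ * x₄ + x₁ * y₂ * x₃ * x₄ + y₁ * x₂ * x₃ * x₄) *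
        (-(Real.cos t ^ 4 / 4))
      + (y₁ * y₂ * y₃ * x₄ + y₁ * y₂ * x₃ * y₄ + y₁ * x₂ * y₃ * y₄ + x₁ * y₂ * y₃ * y₄) *
        (Real.sin t ^ 4 / 4)) (fun t _ => ?_)
    (intervalIntegrable_coe _ _ _)]
  · simp
    ring
  · have hs := Real.hasDerivAt_sin t
    have hc := Real.hasDerivAt_cos t
    have hi := hasDerivAt_id t
    have hsc := (hs.mul hc).const_mul (3 / 8)
    have hc3s := ((hc.pow 3).mul hs).div_const 4
    refine (((((((hi.const_mul (3 / 8)).add hsc).add hc3s).const_mul (x₁ * x₂ * x₃ * x₄)).add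
      ((((hi.const_mul (3 / 8)).sub hsc).sub
        (((hs.pow 3).mul hc).div_const 4)).const_mul (y₁ * y₂ * y₃ * y₄))).add
      ((((hi.const_mul (1 / 8)).add ((hs.mul hc).const_mul (1 / 8))).sub hc3s).const_mul
        (x₁ * x₂ * y₃ * y₄ + x₁ * y₂ * x₃ * y₄ + x₁ * y₂ * y₃ * x₄
          + y₁ * x₂ * x₃ * y₄ + y₁ * x₂ * y₃ * x₄ + y₁ * y₂ * x₃ * x₄))).add
      (((hc.pow 4).div_const 4).neg.const_mul
        (x₁ * x₂ * x₃ * y₄ + x₁ * x₂ * y₃ * x₄ + x₁ * y₂ * x₃ * x₄ + y₁ * x₂ * x₃ * x₄)) |>.add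
      (((hs.pow 4).div_const 4).const_mul
        (y₁ * y₂ * y₃ * x₄ + y₁ * y₂ * x₃ * y₄ + y₁ * x₂ * y₃ * y₄ + x₁ * y₂ * y₃ * y₄))).congr_deriv
          ?_
    simp only [ContinuousMap.coe_mul, Pi.mul_apply, Pi.pow_apply, linForm_coe]
    have h1 : Real.sin t ^ 2 = 1 - Real.cos t ^ 2 := Real.sin_sq t
    have h3 : Real.sin t ^ 3 = Real.sin t * (1 - Real.cos t ^ 2) := by rw [← h1]; ring
    have h4 : Real.sin t ^ 4 = (1 - Real.cos t ^ 2) ^ 2 := by rw [← h1]; ring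
    push_cast
    ring_nf
    simp only [h1, h3, h4]
    ring

end PeriodicFun

namespace DuffingVanDerPol

open PeriodicFun

/-- The position `u cos + v sin` in rotating coordinates `(u, v)`. -/
noncomputable def position (w : PeriodicFun × PeriodicFun) : PeriodicFun :=
  w.1 * cosFun + w.2 * sinFun

/-- The velocity `v cos - u sin` in rotating coordinates `(u, v)`. -/
noncomputable def velocity (w : PeriodicFun × PeriodicFun) : PeriodicFun :=
  w.2 * cosFun - w.1 * sinFun

/-- The perturbing force divided by `ε`, with `ε ^ k` the excess power of the quintic term. -/
noncomputable def force (r a d l : ℝ) (k : ℕ) (p : ℝ × (PeriodicFun × PeriodicFun)) :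
    PeriodicFun :=
  r • velocity p.2 - r • (position p.2 ^ 2 * velocity p.2) - a • position p.2 ^ 3
    - (p.1 ^ k * l) • position p.2 ^ 5 + d • cosFun

/-- The slow vector field in rotating coordinates. -/
noncomputable def slowField (r a d l : ℝ) (k : ℕ) (p : ℝ × (PeriodicFun × PeriodicFun)) :
    PeriodicFun × PeriodicFun :=
  (linForm 0 (-1) * force r a d l k p, linForm 1 0 * force r a d l k p)

theorem contDiff_slowField (r a d l : ℝ) (k : ℕ) : ContDiff ℝ 1 (slowField r a d l k) := by
  unfold slowField force position velocity
  fun_prop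

/-- The inclusion of constants. -/
noncomputable def const : ℝ × ℝ →L[ℝ] PeriodicFun × PeriodicFun :=
  (algebraMapCLM ℝ PeriodicFun).prodMap (algebraMapCLM ℝ PeriodicFun)

theorem position_const (z : ℝ × ℝ) : position (const z) = linForm z.1 z.2 := by
  ext t
  simp [position, const, linForm]

theorem velocity_const (z : ℝ × ℝ) : velocity (const z) = linForm z.2 (-z.1) := by
  ext t
  simp [velocity, const, linForm, sub_eq_add_neg]

/-- The derivative of the force at `ε = 0` at the constant `z` in the constant direction `h`. -/
noncomputable def forceDeriv (r a : ℝ) (z h : ℝ × ℝ) : PeriodicFun :=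
  r • linForm h.2 (-h.1)
    - r • ((2 : ℝ) • (linForm z.1 z.2 * linForm h.1 h.2 * linForm z.2 (-z.1))
      + linForm z.1 z.2 * linForm z.1 z.2 * linForm h.2 (-h.1))
    - (3 * a) • (linForm z.1 z.2 * linForm z.1 z.2 * linForm h.1 h.2)

theorem hasDerivAt_force (r a d l : ℝ) {k : ℕ} (hk : k ≠ 0) (z h : ℝ × ℝ) :
    HasDerivAt (fun τ : ℝ => force r a d l k (0, const z + τ • const h))
      (forceDeriv r a z h) 0 := by
  have hX : HasDerivAt (fun τ : ℝ => linForm z.1 z.2 + τ • linForm h.1 h.2)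
      (linForm h.1 h.2) 0 := by
    simpa using ((hasDerivAt_id (0 : ℝ)).smul_const (linForm h.1 h.2)).const_add (linForm z.1 z.2)
  have hY : HasDerivAt (fun τ : ℝ => linForm z.2 (-z.1) + τ • linForm h.2 (-h.1))
      (linForm h.2 (-h.1)) 0 := by
    simpa using
      ((hasDerivAt_id (0 : ℝ)).smul_const (linForm h.2 (-h.1))).const_add (linForm z.2 (-z.1))
  have hF := ((((hY.const_smul r).sub (((hX.pow 2).mul hY).const_smul r)).sub
    ((hX.pow 3).const_smul a))).add_const (d • cosFun)
  have hfun : (fun τ : ℝ => force r a d l k (0, const z + τ • const h)) = fun τ =>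
      r • (linForm z.2 (-z.1) + τ • linForm h.2 (-h.1))
        - r • ((linForm z.1 z.2 + τ • linForm h.1 h.2) ^ 2
          * (linForm z.2 (-z.1) + τ • linForm h.2 (-h.1)))
        - a • (linForm z.1 z.2 + τ • linForm h.1 h.2) ^ 3 + d • cosFun := by
    funext τ
    have e : const z + τ • const h = const (z + τ • h) := by simp
    rw [e, force, position_const, velocity_const]
    ext t
    simp [linForm, hk]
    ring
  rw [hfun]
  refine HasDerivAt.congr_deriv hF ?_
  ext t
  have h2 : (2 : PeriodicFun) t = 2 := rfl
  have h3 : (3 : PeriodicFun) t = 3 := rfl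
  simp [forceDeriv, h2, h3]
  ring

/-- Componentwise integration over a period. -/
noncomputable def average : PeriodicFun × PeriodicFun →L[ℝ] ℝ × ℝ :=
  periodIntegral.prodMap periodIntegral

theorem average_slowField_const (r a d l : ℝ) {k : ℕ} (hk : k ≠ 0) {z : ℝ × ℝ}
    (hz : sys6 r a d z) : average (slowField r a d l k (0, const z)) = 0 := by
  have key (p q : ℝ) : periodIntegral (linForm p q * force r a d l k (0, const z)) =
      r * periodIntegral (linForm p q * linForm z.2 (-z.1))
      - r * periodIntegral
        (linForm p q * linForm z.1 z.2 * linForm z.1 z.2 * linForm z.2 (-z.1))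
      - a * periodIntegral (linForm p q * linForm z.1 z.2 * linForm z.1 z.2 * linForm z.1 z.2)
      + d * periodIntegral (linForm p q * linForm 1 0) := by
    simp only [← smul_eq_mul, ← map_smul, ← map_sub, ← map_add]
    congr 1
    rw [force, position_const, velocity_const]
    ext t
    simp [linForm, hk]
    ring
  simp only [periodIntegral_mul_linForm, periodIntegral_mul_mul_mul_linForm] at key
  obtain ⟨h1, h2⟩ := hz
  ext
  · change periodIntegral (linForm 0 (-1) * _) = 0
    rw [key]
    linear_combination -(Real.pi / 4) * h1
  · change periodIntegral (linForm 1 0 * _) = 0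
    rw [key]
    linear_combination (Real.pi / 4) * h2

theorem periodIntegral_linForm_mul_forceDeriv (r a p q : ℝ) (z h : ℝ × ℝ) :
    periodIntegral (linForm p q * forceDeriv r a z h) =
      r * periodIntegral (linForm p q * linForm h.2 (-h.1))
      - r * (2 * periodIntegral
          (linForm p q * linForm z.1 z.2 * linForm h.1 h.2 * linForm z.2 (-z.1))
        + periodIntegral
          (linForm p q * linForm z.1 z.2 * linForm z.1 z.2 * linForm h.2 (-h.1)))
      - 3 * a * periodIntegral
        (linForm p q * linForm z.1 z.2 * linForm z.1 z.2 * linForm h.1 h.2) := by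
  simp only [← smul_eq_mul, ← map_smul, ← map_sub, ← map_add]
  congr 1
  ext t
  simp [forceDeriv]
  ring

theorem fderiv_slowField_const (r a d l : ℝ) {k : ℕ} (hk : k ≠ 0) (z h : ℝ × ℝ) :
    fderiv ℝ (fun w => slowField r a d l k (0, w)) (const z) (const h) =
      (linForm 0 (-1) * forceDeriv r a z h, linForm 1 0 * forceDeriv r a z h) := by
  have hdiff : DifferentiableAt ℝ (fun w => slowField r a d l k (0, w)) (const z) :=
    ((contDiff_slowField r a d l k).differentiable one_ne_zero _).comp _ (by fun_prop)
  have hline : HasDerivAt (fun τ : ℝ => const z + τ • const h) (const h) 0 := by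
    simpa using ((hasDerivAt_id (0 : ℝ)).smul_const (const h)).const_add (const z)
  have h1 : HasDerivAt (fun τ : ℝ => slowField r a d l k (0, const z + τ • const h))
      (fderiv ℝ (fun w => slowField r a d l k (0, w)) (const z) (const h)) 0 :=
    HasFDerivAt.comp_hasDerivAt_of_eq (0 : ℝ) hdiff.hasFDerivAt hline (by simp)
  have hF := hasDerivAt_force r a d l hk z h
  exact h1.unique ((hF.const_mul _).prodMk (hF.const_mul _))

theorem bijective_average_fderiv (r a d l : ℝ) {k : ℕ} (hk : k ≠ 0) {z : ℝ × ℝ}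
    (hz : 27 * a ^ 2 * (z.1 ^ 2 + z.2 ^ 2) ^ 2
      + r ^ 2 * (-4 + z.1 ^ 2 + z.2 ^ 2) * (-4 + 3 * z.1 ^ 2 + 3 * z.2 ^ 2) ≠ 0) :
    Function.Bijective fun h =>
      average (fderiv ℝ (fun w => slowField r a d l k (0, w)) (const z) (const h)) := by
  let J : ℝ × ℝ →ₗ[ℝ] ℝ × ℝ :=
    (average ∘L fderiv ℝ (fun w => slowField r a d l k (0, w)) (const z) ∘L const).toLinearMap
  have hJ : Function.Injective J := by
    refine (injective_iff_map_eq_zero J).2 fun h h0 => ?_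
    change average (fderiv ℝ (fun w => slowField r a d l k (0, w)) (const z) (const h)) = 0 at h0
    rw [fderiv_slowField_const r a d l hk] at h0
    have h1 : periodIntegral (linForm 0 (-1) * forceDeriv r a z h) = 0 := congrArg Prod.fst h0
    have h2 : periodIntegral (linForm 1 0 * forceDeriv r a z h) = 0 := congrArg Prod.snd h0
    simp only [periodIntegral_linForm_mul_forceDeriv, periodIntegral_mul_linForm,
      periodIntegral_mul_mul_mul_linForm] at h1 h2
    obtain ⟨x, y⟩ := z
    obtain ⟨u, v⟩ := h
    dsimp only at h1 h2 hz
    have hne := mul_ne_zero (div_ne_zero Real.pi_pos.ne' (four_ne_zero (α := ℝ))) hz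
    ext
    · refine (mul_eq_zero.1 ?_).resolve_left hne
      linear_combination
        (4 * r - r * (x ^ 2 + y ^ 2) - 2 * r * y ^ 2 - 6 * a * x * y) * h1
        - (-2 * r * x * y + 3 * a * (x ^ 2 + y ^ 2) + 6 * a * y ^ 2) * h2
    · refine (mul_eq_zero.1 ?_).resolve_left hne
      linear_combination
        (4 * r - r * (x ^ 2 + y ^ 2) - 2 * r * x ^ 2 + 6 * a * x * y) * h2
        - (-2 * r * x * y - 3 * a * (x ^ 2 + y ^ 2) - 6 * a * x ^ 2) * h1
  exact ⟨hJ, LinearMap.injective_iff_surjective.1 hJ⟩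

/-- Evaluation at time `0`. -/
noncomputable def initialValue : PeriodicFun × PeriodicFun →L[ℝ] ℝ × ℝ :=
  (ContinuousMap.evalCLM ℝ 0).prodMap (ContinuousMap.evalCLM ℝ 0)

/-- A nondegenerate zero of the averaged system continues to a branch of periodic solutions. -/
theorem exists_periodic_branch (r a d l : ℝ) {n : ℤ} (hn : 1 < n) {z : ℝ × ℝ}
    (hz : sys6 r a d z)
    (hnd : 27 * a ^ 2 * (z.1 ^ 2 + z.2 ^ 2) ^ 2
      + r ^ 2 * (-4 + z.1 ^ 2 + z.2 ^ 2) * (-4 + 3 * z.1 ^ 2 + 3 * z.2 ^ 2) ≠ 0) :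
    ∃ X Y : ℝ → ℝ → ℝ,
      (∀ᶠ ε in 𝓝[>] (0 : ℝ),
        (∀ t, HasDerivAt (X ε) (Y ε t) t) ∧
        (∀ t, HasDerivAt (Y ε)
          (-(X ε t) + ε * r * Y ε t - ε * r * (X ε t) ^ 2 * Y ε t
            - ε * a * (X ε t) ^ 3 - ε ^ n * l * (X ε t) ^ 5
            + ε * d * Real.cos t) t) ∧
        (∀ t, X ε (t + 2 * Real.pi) = X ε t) ∧
        (∀ t, Y ε (t + 2 * Real.pi) = Y ε t)) ∧
      Tendsto (fun ε => (X ε 0, Y ε 0)) (𝓝[>] 0) (𝓝 z) := by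
  obtain ⟨k, rfl⟩ : ∃ k : ℕ, n = (k + 1 : ℕ) := ⟨(n - 1).toNat, by omega⟩
  have hk : k ≠ 0 := by omega
  have hdiff : DifferentiableAt ℝ (fun w => slowField r a d l k (0, w)) (const z) :=
    ((contDiff_slowField r a d l k).differentiable one_ne_zero _).comp _ (by fun_prop)
  obtain ⟨w, hw, hsol⟩ := exists_branch_of_bijective_average const initialValue average
    (primitive.prodMap primitive) (fun v => by ext <;> simp [initialValue, const])
    (fun x => by ext <;> simp [initialValue, primitive_zero])
    (contDiff_slowField r a d l k).contDiffAt hdiff.hasFDerivAt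
    (average_slowField_const r a d l hk hz) (bijective_average_fderiv r a d l hk hnd)
  refine ⟨fun ε t => position (w ε) t, fun ε t => velocity (w ε) t, ?_, ?_⟩
  · filter_upwards [hsol.filter_mono nhdsWithin_le_nhds] with ε ⟨hmean, hfix⟩
    set F := force r a d l k (ε, w ε) with hF
    have hu (t : ℝ) : HasDerivAt (fun s : ℝ => (w ε).1 s) (ε * (-Real.sin t * F t)) t := by
      have hp := (hasDerivAt_primitive (f := linForm 0 (-1) * F)
        (congrArg Prod.fst hmean) t).const_mul ε |>.const_add ((w ε).1 0)
      have e : (fun s : ℝ => (w ε).1 s) =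
          fun s : ℝ => (w ε).1 0 + ε * primitive (linForm 0 (-1) * F) s := by
        funext s
        exact congrArg (fun p => p.1 (s : AddCircle (2 * Real.pi))) hfix
      rw [e]
      exact hp.congr_deriv (by simp [linForm_coe])
    have hv (t : ℝ) : HasDerivAt (fun s : ℝ => (w ε).2 s) (ε * (Real.cos t * F t)) t := by
      have hp := (hasDerivAt_primitive (f := linForm 1 0 * F)
        (congrArg Prod.snd hmean) t).const_mul ε |>.const_add ((w ε).2 0)
      have e : (fun s : ℝ => (w ε).2 s) =
          fun s : ℝ => (w ε).2 0 + ε * primitive (linForm 1 0 * F) s := by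
        funext s
        exact congrArg (fun p => p.2 (s : AddCircle (2 * Real.pi))) hfix
      rw [e]
      exact hp.congr_deriv (by simp [linForm_coe])
    have hc := Real.hasDerivAt_cos
    have hs := Real.hasDerivAt_sin
    refine ⟨fun t => ?_, fun t => ?_, periodic_coe _, periodic_coe _⟩
    · refine (((hu t).mul (hc t)).add ((hv t).mul (hs t))).congr_deriv ?_
      simp [velocity]
      ring
    · refine (((hv t).mul (hc t)).sub ((hu t).mul (hs t))).congr_deriv ?_
      have hFt : ε * F t = ε * r * velocity (w ε) t
          - ε * r * position (w ε) t ^ 2 * velocity (w ε) t - ε * a * position (w ε) t ^ 3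
          - ε ^ ((k + 1 : ℕ) : ℤ) * l * position (w ε) t ^ 5 + ε * d * Real.cos t := by
        rw [zpow_natCast]
        simp [hF, force]
        ring
      have hX : position (w ε) t = (w ε).1 t * Real.cos t + (w ε).2 t * Real.sin t := rfl
      linear_combination hFt + hX + ε * F t * Real.sin_sq_add_cos_sq t
  · have h1 := ((initialValue.continuous.tendsto _).comp hw).mono_left
      (nhdsWithin_le_nhds (s := Set.Ioi 0))
    have h2 : initialValue (const z) = z := by ext <;> simp [initialValue, const]
    rw [h2] at h1
    refine h1.congr fun ε => ?_
    have hc : cosFun 0 = 1 := (cosFun_coe 0).trans Real.cos_zero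
    have hs : sinFun 0 = 0 := (sinFun_coe 0).trans Real.sin_zero
    ext <;> simp [initialValue, position, velocity, hc, hs]

/-- The cubic whose roots are the squared amplitudes of the solutions of `sys6`. -/
def amplitudeCubic (r a d ρ : ℝ) : ℝ :=
  (r ^ 2 + 9 * a ^ 2) * ρ ^ 3 - 8 * r ^ 2 * ρ ^ 2 + 16 * r ^ 2 * ρ - 16 * d ^ 2

theorem amplitudeCubic_eq_zero {r a d : ℝ} {z : ℝ × ℝ} (hz : sys6 r a d z) :
    amplitudeCubic r a d (z.1 ^ 2 + z.2 ^ 2) = 0 := by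
  obtain ⟨x, y⟩ := z
  obtain ⟨h1, h2⟩ := hz
  dsimp only at h1 h2
  unfold amplitudeCubic
  linear_combination (r * x * (-4 + x ^ 2 + y ^ 2) - 3 * a * y * (x ^ 2 + y ^ 2)) * h1
    - (4 * d + r * y * (-4 + x ^ 2 + y ^ 2) + 3 * a * x * (x ^ 2 + y ^ 2)) * h2

theorem coefficient_ne_zero {r a d ρ : ℝ} (hd : 0 < d) (hρ : amplitudeCubic r a d ρ = 0) :
    (r * (ρ - 4)) ^ 2 + (3 * a * ρ) ^ 2 ≠ 0 := by
  intro h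
  have : 16 * d ^ 2 = 0 := by
    unfold amplitudeCubic at hρ
    linear_combination ρ * h - hρ
  exact (by positivity : 16 * d ^ 2 ≠ 0) this

theorem eq_of_sys6 {r a d : ℝ} (hd : 0 < d) {z w : ℝ × ℝ} (hz : sys6 r a d z)
    (hw : sys6 r a d w) (h : w.1 ^ 2 + w.2 ^ 2 = z.1 ^ 2 + z.2 ^ 2) : w = z := by
  have hN := coefficient_ne_zero hd (amplitudeCubic_eq_zero hz)
  obtain ⟨x, y⟩ := z
  obtain ⟨x', y'⟩ := w
  obtain ⟨h1, h2⟩ := hz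
  obtain ⟨h3, h4⟩ := hw
  dsimp only at h h1 h2 h3 h4 hN
  rw [add_assoc, h] at h3 h4
  rw [add_assoc] at h1 h2
  set ρ := x ^ 2 + y ^ 2
  ext <;> refine mul_left_cancel₀ hN ?_
  · linear_combination r * (ρ - 4) * (h3 - h1) - 3 * a * ρ * (h4 - h2)
  · linear_combination -(3 * a * ρ) * (h3 - h1) - r * (ρ - 4) * (h4 - h2)

theorem exists_sys6_of_amplitude {r a d ρ : ℝ} (hd : 0 < d) (hρ : amplitudeCubic r a d ρ = 0) :
    ∃ z : ℝ × ℝ, sys6 r a d z ∧ z.1 ^ 2 + z.2 ^ 2 = ρ := by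
  have hN := coefficient_ne_zero hd hρ
  set N := (r * (ρ - 4)) ^ 2 + (3 * a * ρ) ^ 2 with hNdef
  have hNρ : N * ρ = 16 * d ^ 2 := by
    unfold amplitudeCubic at hρ
    linear_combination hρ + ρ * hNdef
  have hsq : (4 * d * (3 * a * ρ) / N) ^ 2 + (4 * d * (r * (ρ - 4)) / N) ^ 2 = ρ := by
    field_simp
    linear_combination -(16 * d ^ 2) * hNdef - N * hNρ
  refine ⟨(4 * d * (3 * a * ρ) / N, 4 * d * (r * (ρ - 4)) / N), ⟨?_, ?_⟩, hsq⟩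
  · dsimp only
    rw [add_assoc, hsq]
    ring
  · dsimp only
    rw [add_assoc, hsq]
    field_simp
    linear_combination 4 * d * hNdef

theorem exists_amplitudeCubic_eq_zero {r : ℝ} (a d : ℝ) (hr : 0 < r) :
    ∃ ρ, amplitudeCubic r a d ρ = 0 := by
  have hcont : Continuous (amplitudeCubic r a d) := by
    unfold amplitudeCubic
    fun_prop
  have hM : 0 ≤ d ^ 2 / r ^ 2 := by positivity
  have h0 : amplitudeCubic r a d 0 ≤ 0 := by
    unfold amplitudeCubic
    nlinarith [sq_nonneg d]
  have h1 : 0 ≤ amplitudeCubic r a d (8 + d ^ 2 / r ^ 2) := by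
    set m := d ^ 2 / r ^ 2 with hm
    have hdm : d ^ 2 = r ^ 2 * m := by
      rw [hm]
      field_simp
    have : amplitudeCubic r a d (8 + m) = 9 * a ^ 2 * (8 + m) ^ 3
        + r ^ 2 * (m * (8 + m) ^ 2 + 128) := by
      unfold amplitudeCubic
      linear_combination -16 * hdm
    rw [this]
    positivity
  obtain ⟨ρ, -, hρ⟩ := intermediate_value_Icc (by positivity : (0 : ℝ) ≤ 8 + d ^ 2 / r ^ 2)
    hcont.continuousOn ⟨h0, h1⟩
  exact ⟨ρ, hρ⟩

section Roots

variable {r a d ρ : ℝ}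

/-- The discriminant of the cofactor of `X - ρ` in the amplitude cubic. -/
def cofactorDiscrim (r a ρ : ℝ) : ℝ :=
  (-8 * r ^ 2 + (r ^ 2 + 9 * a ^ 2) * ρ) ^ 2 - 4 * (r ^ 2 + 9 * a ^ 2) *
    (16 * r ^ 2 + (-8 * r ^ 2 + (r ^ 2 + 9 * a ^ 2) * ρ) * ρ)

theorem cofactorDiscrim_mul_sq (hρ : amplitudeCubic r a d ρ = 0) :
    cofactorDiscrim r a ρ *
      (3 * (r ^ 2 + 9 * a ^ 2) * ρ ^ 2 - 16 * r ^ 2 * ρ + 16 * r ^ 2) ^ 2 =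
      -256 * delta2 a d r := by
  unfold amplitudeCubic at hρ
  unfold cofactorDiscrim delta2
  set E := ρ * (16 * r ^ 2 + (-8 * r ^ 2 + (r ^ 2 + 9 * a ^ 2) * ρ) * ρ) / 16 with hE
  linear_combination (-16 : ℝ) * (27 * (r ^ 2 + 9 * a ^ 2) ^ 2 * (d ^ 2 + E)
    - 16 * r ^ 6 - 1296 * a ^ 2 * r ^ 4) * hρ

theorem amplitudeCubic_eq_zero_iff (hr : 0 < r) (hρ : amplitudeCubic r a d ρ = 0) (σ : ℝ) :
    amplitudeCubic r a d σ = 0 ↔ σ = ρ ∨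
      (2 * (r ^ 2 + 9 * a ^ 2) * σ + (-8 * r ^ 2 + (r ^ 2 + 9 * a ^ 2) * ρ)) ^ 2 =
        cofactorDiscrim r a ρ := by
  have hA : 4 * (r ^ 2 + 9 * a ^ 2) ≠ 0 := by positivity
  have key : 4 * (r ^ 2 + 9 * a ^ 2) * amplitudeCubic r a d σ = (σ - ρ) *
      ((2 * (r ^ 2 + 9 * a ^ 2) * σ + (-8 * r ^ 2 + (r ^ 2 + 9 * a ^ 2) * ρ)) ^ 2 -
        cofactorDiscrim r a ρ) := by
    unfold amplitudeCubic at hρ ⊢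
    unfold cofactorDiscrim
    linear_combination 4 * (r ^ 2 + 9 * a ^ 2) * hρ
  rw [← mul_right_inj' hA, mul_zero, key, mul_eq_zero, sub_eq_zero, sub_eq_zero]

theorem amplitude_unique (hr : 0 < r) (hΔ : 0 < delta2 a d r) (hρ : amplitudeCubic r a d ρ = 0)
    {σ : ℝ} (hσ : amplitudeCubic r a d σ = 0) : σ = ρ := by
  refine ((amplitudeCubic_eq_zero_iff hr hρ σ).1 hσ).resolve_right fun h => ?_
  have := cofactorDiscrim_mul_sq hρ
  rw [← h, ← mul_pow] at this
  nlinarith [sq_nonneg ((2 * (r ^ 2 + 9 * a ^ 2) * σ + (-8 * r ^ 2 + (r ^ 2 + 9 * a ^ 2) * ρ)) *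
    (3 * (r ^ 2 + 9 * a ^ 2) * ρ ^ 2 - 16 * r ^ 2 * ρ + 16 * r ^ 2))]

theorem exists_three_amplitudes (a d : ℝ) (hr : 0 < r) (hΔ : delta2 a d r < 0) :
    ∃ σ : Fin 3 → ℝ, Function.Injective σ ∧ (∀ i, amplitudeCubic r a d (σ i) = 0) ∧
      ∀ τ, amplitudeCubic r a d τ = 0 → ∃ i, τ = σ i := by
  obtain ⟨ρ, hρ⟩ := exists_amplitudeCubic_eq_zero a d hr
  have hprod := cofactorDiscrim_mul_sq hρ
  have hdisc : 0 < cofactorDiscrim r a ρ := by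
    by_contra! h
    nlinarith [mul_nonneg (neg_nonneg.2 h)
      (sq_nonneg (3 * (r ^ 2 + 9 * a ^ 2) * ρ ^ 2 - 16 * r ^ 2 * ρ + 16 * r ^ 2))]
  have hroot := amplitudeCubic_eq_zero_iff hr hρ
  have hA : 0 < r ^ 2 + 9 * a ^ 2 := by positivity
  have hρne : (2 * (r ^ 2 + 9 * a ^ 2) * ρ + (-8 * r ^ 2 + (r ^ 2 + 9 * a ^ 2) * ρ)) ^ 2 ≠
      cofactorDiscrim r a ρ := by
    intro h
    have h0 : 3 * (r ^ 2 + 9 * a ^ 2) * ρ ^ 2 - 16 * r ^ 2 * ρ + 16 * r ^ 2 = 0 := by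
      refine (mul_eq_zero.1 ?_).resolve_left (by positivity : 4 * (r ^ 2 + 9 * a ^ 2) ≠ 0)
      unfold cofactorDiscrim at h
      linear_combination h
    rw [h0] at hprod
    linarith
  set s := Real.sqrt (cofactorDiscrim r a ρ)
  have hs : 0 < s := Real.sqrt_pos.2 hdisc
  have hss : s ^ 2 = cofactorDiscrim r a ρ := Real.sq_sqrt hdisc.le
  set A := r ^ 2 + 9 * a ^ 2
  set b := -8 * r ^ 2 + A * ρ
  have hlin (y : ℝ) : 2 * A * ((y - b) / (2 * A)) + b = y := by
    field_simp
    ring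
  have hplus : (2 * A * ((s - b) / (2 * A)) + b) ^ 2 = cofactorDiscrim r a ρ := by
    rw [hlin, hss]
  have hminus : (2 * A * ((-s - b) / (2 * A)) + b) ^ 2 = cofactorDiscrim r a ρ := by
    rw [hlin, neg_sq, hss]
  have h1 : ρ ≠ (s - b) / (2 * A) := fun h => hρne (by rwa [← h] at hplus)
  have h2 : ρ ≠ (-s - b) / (2 * A) := fun h => hρne (by rwa [← h] at hminus)
  have h3 : (s - b) / (2 * A) ≠ (-s - b) / (2 * A) := fun h => by
    have := hlin s
    rw [h, hlin] at this
    linarith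
  refine ⟨![ρ, (s - b) / (2 * A), (-s - b) / (2 * A)], ?_, ?_, fun τ hτ => ?_⟩
  · intro i j hij
    fin_cases i <;> fin_cases j <;> simp_all
  · intro i
    fin_cases i
    · exact hρ
    · exact (hroot _).2 (Or.inr hplus)
    · exact (hroot _).2 (Or.inr hminus)
  · rcases (hroot τ).1 hτ with h | h
    · exact ⟨0, h⟩
    · rw [← hss] at h
      rcases sq_eq_sq_iff_eq_or_eq_neg.1 h with h | h
      · exact ⟨1, by
          change τ = (s - b) / (2 * A)
          rw [eq_div_iff (by positivity)]
          linear_combination h⟩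
      · exact ⟨2, by
          change τ = (-s - b) / (2 * A)
          rw [eq_div_iff (by positivity)]
          linear_combination h⟩

theorem delta2_ne_zero (hr : 0 < r)
    (hsimple : ∀ σ, amplitudeCubic r a d σ = 0 →
      3 * (r ^ 2 + 9 * a ^ 2) * σ ^ 2 - 16 * r ^ 2 * σ + 16 * r ^ 2 ≠ 0) :
    delta2 a d r ≠ 0 := by
  intro hΔ
  obtain ⟨ρ, hρ⟩ := exists_amplitudeCubic_eq_zero a d hr
  have hprod := cofactorDiscrim_mul_sq hρ
  have hdisc : cofactorDiscrim r a ρ = 0 := by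
    refine (mul_eq_zero.1 ?_).resolve_right (pow_ne_zero 2 (hsimple ρ hρ))
    rw [hprod, hΔ, mul_zero]
  have hA : 0 < r ^ 2 + 9 * a ^ 2 := by positivity
  obtain ⟨σ, hσ⟩ : ∃ σ, 2 * (r ^ 2 + 9 * a ^ 2) * σ
      + (-8 * r ^ 2 + (r ^ 2 + 9 * a ^ 2) * ρ) = 0 :=
    ⟨(8 * r ^ 2 - (r ^ 2 + 9 * a ^ 2) * ρ) / (2 * (r ^ 2 + 9 * a ^ 2)), by
      field_simp
      ring⟩
  refine hsimple σ ((amplitudeCubic_eq_zero_iff hr hρ σ).2 (Or.inr ?_)) ?_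
  · rw [hσ, hdisc]
    norm_num
  · refine (mul_eq_zero.1 ?_).resolve_left (by positivity : 4 * (r ^ 2 + 9 * a ^ 2) ≠ 0)
    unfold cofactorDiscrim at hdisc
    linear_combination (2 * (r ^ 2 + 9 * a ^ 2) * σ + (-8 * r ^ 2 + (r ^ 2 + 9 * a ^ 2) * ρ)
      + 4 * (r ^ 2 + 9 * a ^ 2) * (σ - ρ)) * hσ - hdisc

end Roots

end DuffingVanDerPol

open DuffingVanDerPol

/-- Theorem 6 of the paper.
For `(ρ, α, δ, λ) = (εr, εa, εd, ε^{n₃}ℓ)` with `n₃ > 1`: the algebraic system has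
exactly one solution if `Δ₁Δ₂ = 0` or `Δ₂ > 0`, and exactly three if `Δ₂ < 0`;
under the displayed nondegeneracy the full system has correspondingly one or
three distinct `2π`-periodic solutions converging to these algebraic solutions,
and both alternatives are realizable. -/
theorem stmt_5 (r a d l : ℝ) (n₃ : ℤ)
    (hr : 0 < r) (hd : 0 < d)
    (hc : -324 * a ^ 4 * r ^ 2 - 9 * a ^ 2 * d ^ 2 * r ^ 2 + 36 * a ^ 2 * r ^ 4
            - d ^ 2 * r ^ 4 ≠ 0)
    (hn₃ : 1 < n₃) (hl : l ≠ 0)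
    (hnd : ∀ z : ℝ × ℝ, sys6 r a d z →
      27 * a ^ 2 * (z.1 ^ 2 + z.2 ^ 2) ^ 2
        + r ^ 2 * (-4 + z.1 ^ 2 + z.2 ^ 2) * (-4 + 3 * z.1 ^ 2 + 3 * z.2 ^ 2) ≠ 0) :
    (delta1 a d r * delta2 a d r = 0 ∨ delta2 a d r > 0 →
      ∃ z₀ : ℝ × ℝ, sys6 r a d z₀ ∧ (∀ w, sys6 r a d w → w = z₀) ∧
        ∃ ε₀ > (0 : ℝ), ∃ X Y : ℝ → ℝ → ℝ,
          (∀ ε ∈ Set.Ioo (0 : ℝ) ε₀,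
            (∀ t, HasDerivAt (X ε) (Y ε t) t) ∧
            (∀ t, HasDerivAt (Y ε)
              (-(X ε t) + ε * r * Y ε t - ε * r * (X ε t) ^ 2 * Y ε t
                - ε * a * (X ε t) ^ 3 - ε ^ n₃ * l * (X ε t) ^ 5
                + ε * d * Real.cos t) t) ∧
            (∀ t, X ε (t + 2 * Real.pi) = X ε t) ∧
            (∀ t, Y ε (t + 2 * Real.pi) = Y ε t)) ∧
          Filter.Tendsto (fun ε => (X ε 0, Y ε 0)) (nhdsWithin 0 (Set.Ioi 0))
            (nhds z₀)) ∧
    (delta2 a d r < 0 →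
      ∃ z : Fin 3 → ℝ × ℝ, Function.Injective z ∧
        (∀ i, sys6 r a d (z i)) ∧
        (∀ w, sys6 r a d w → ∃ i, w = z i) ∧
        ∃ ε₀ > (0 : ℝ), ∃ X Y : Fin 3 → ℝ → ℝ → ℝ,
          (∀ i, ∀ ε ∈ Set.Ioo (0 : ℝ) ε₀,
            (∀ t, HasDerivAt (X i ε) (Y i ε t) t) ∧
            (∀ t, HasDerivAt (Y i ε)
              (-(X i ε t) + ε * r * Y i ε t - ε * r * (X i ε t) ^ 2 * Y i ε t
                - ε * a * (X i ε t) ^ 3 - ε ^ n₃ * l * (X i ε t) ^ 5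
                + ε * d * Real.cos t) t) ∧
            (∀ t, X i ε (t + 2 * Real.pi) = X i ε t) ∧
            (∀ t, Y i ε (t + 2 * Real.pi) = Y i ε t)) ∧
          (∀ ε ∈ Set.Ioo (0 : ℝ) ε₀, ∀ i j, i ≠ j →
            (X i ε 0, Y i ε 0) ≠ (X j ε 0, Y j ε 0)) ∧
          (∀ i, Filter.Tendsto (fun ε => (X i ε 0, Y i ε 0))
            (nhdsWithin 0 (Set.Ioi 0)) (nhds (z i)))) ∧
    (∃ r' a' d' : ℝ, 0 < r' ∧ 0 < d' ∧ delta2 a' d' r' > 0) ∧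
    (∃ r' a' d' : ℝ, 0 < r' ∧ 0 < d' ∧ delta2 a' d' r' < 0) := by
  have hΔ₁ : delta1 a d r ≠ 0 := by
    intro h
    unfold delta1 at h
    exact hc (by linear_combination -r ^ 2 * h)
  have hΔ₂ : delta2 a d r ≠ 0 := by
    refine delta2_ne_zero hr fun σ hσ h => ?_
    obtain ⟨z, hz, rfl⟩ := exists_sys6_of_amplitude hd hσ
    exact hnd z hz (by linear_combination h)
  refine ⟨fun h => ?_, fun h => ?_, ⟨1, 0, 1, ?_⟩, ⟨1, 0, 1 / 2, ?_⟩⟩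
  · replace h : 0 < delta2 a d r := h.resolve_left (mul_ne_zero hΔ₁ hΔ₂)
    obtain ⟨ρ, hρ⟩ := exists_amplitudeCubic_eq_zero a d hr
    obtain ⟨z, hz, -⟩ := exists_sys6_of_amplitude hd hρ
    obtain ⟨X, Y, hXY, hlim⟩ :=
      exists_periodic_branch r a d l hn₃ hz (hnd z hz)
    obtain ⟨ε₀, hε₀, hsub⟩ := mem_nhdsGT_iff_exists_Ioo_subset.1 hXY
    exact ⟨z, hz, fun w hw => eq_of_sys6 hd hz hw
      (amplitude_unique hr h (amplitudeCubic_eq_zero hz)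
        (amplitudeCubic_eq_zero hw)), ε₀, hε₀, X, Y, hsub, hlim⟩
  · obtain ⟨σ, hσ, hroot, hall⟩ := exists_three_amplitudes a d hr h
    choose z hz hzσ using fun i => exists_sys6_of_amplitude hd (hroot i)
    have hinj : Function.Injective z := fun i j hij => hσ (by rw [← hzσ i, ← hzσ j, hij])
    choose X Y hXY hlim using fun i =>
      exists_periodic_branch r a d l hn₃ (hz i) (hnd (z i) (hz i))
    have hdist : ∀ᶠ ε in 𝓝[>] (0 : ℝ), ∀ i j, i ≠ j →
        (X i ε 0, Y i ε 0) ≠ (X j ε 0, Y j ε 0) := by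
      refine eventually_all.2 fun i => eventually_all.2 fun j => ?_
      by_cases hij : i = j
      · simp [hij]
      · obtain ⟨U, V, hU, hV, hiU, hjV, hUV⟩ := t2_separation (hinj.ne hij)
        filter_upwards [hlim i (hU.mem_nhds hiU), hlim j (hV.mem_nhds hjV)] with ε hi hj _
        exact hUV.ne_of_mem hi hj
    obtain ⟨ε₀, hε₀, hsub⟩ :=
      mem_nhdsGT_iff_exists_Ioo_subset.1 ((eventually_all.2 hXY).and hdist)
    refine ⟨z, hinj, hz, fun w hw => ?_, ε₀, hε₀, X, Y, fun i ε hε => (hsub hε).1 i,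
      fun ε hε => (hsub hε).2, hlim⟩
    obtain ⟨i, hi⟩ := hall _ (amplitudeCubic_eq_zero hw)
    exact ⟨i, eq_of_sys6 hd (hz i) hw (by rw [hi, hzσ i])⟩
  · norm_num [delta2]
  · norm_num [delta2]
end
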